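/- arXiv:math/0609401 — 4 statements merged into one kernel-verified Lean document; each statement's English description precedes it below -/
import Mathlib

section
/- The minimal cardinality of a set of reals X such that the space C_p(X) of continuous real-valued functions on X with the topology of pointwise convergence does not have the Pytkeev property equals the pseudo-intersection number 𝔭. -/
open Cardinal

/-- The Pytkeev property: for every point `y` in the closure of `A \ {y}` there are
infinite subsets `A n ⊆ A` such that every neighborhood of `y` contains some `A n`. -/
def PytkeevProperty (Y : Type*) [TopologicalSpace Y] : Prop :=
  ∀ (y : Y) (A : Set Y), y ∈ closure (A \ {y}) →
    ∃ As : ℕ → Set Y, (∀ n, (As n).Infinite ∧ As n ⊆ A) ∧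
      ∀ U ∈ nhds y, ∃ n, As n ⊆ U

/-- `Cp X`: the continuous real-valued functions on `X` with the topology of pointwise
convergence (subspace of the product `X → ℝ`). -/
def Cp (X : Set ℝ) : Type := {f : X → ℝ // Continuous f}

instance (X : Set ℝ) : TopologicalSpace (Cp X) :=
  instTopologicalSpaceSubtype

/-- The pseudo-intersection number 𝔭. -/
noncomputable def pseudoIntersectionNumber : Cardinal :=
  sInf {c : Cardinal | ∃ F : Set (Set ℕ), #F = c ∧
    (∀ A ∈ F, A.Infinite) ∧
    (∀ S : Finset (Set ℕ), ↑S ⊆ F → (⋂ A ∈ S, A).Infinite) ∧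
    ¬ ∃ P : Set ℕ, P.Infinite ∧ ∀ A ∈ F, (P \ A).Finite}

section Combinatorics

open Filter

/-- Every finite subfamily of `F` has infinite intersection. -/
def Centered (F : Set (Set ℕ)) : Prop :=
  ∀ S : Finset (Set ℕ), ↑S ⊆ F → (⋂ A ∈ S, A).Infinite

/-- `F` has an infinite pseudo-intersection. -/
def HasPseudoIntersection (F : Set (Set ℕ)) : Prop :=
  ∃ P : Set ℕ, P.Infinite ∧ ∀ A ∈ F, (P \ A).Finite

/-- There are countably many infinite sets such that every finite intersection of members of
`F` contains one of them. -/
def HasCountablePiNetwork (F : Set (Set ℕ)) : Prop :=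
  ∃ A : ℕ → Set ℕ, (∀ n, (A n).Infinite) ∧
    ∀ S : Finset (Set ℕ), ↑S ⊆ F → ∃ n, A n ⊆ ⋂ B ∈ S, B

/-- Any two members of `T` are comparable under almost inclusion. -/
def IsAlmostChain (T : Set (Set ℕ)) : Prop :=
  ∀ A ∈ T, ∀ B ∈ T, (A \ B).Finite ∨ (B \ A).Finite

lemma diff_finite_trans {A B C : Set ℕ} (h₁ : (A \ B).Finite) (h₂ : (B \ C).Finite) :
    (A \ C).Finite :=
  (h₁.union h₂).subset fun x hx => by
    by_cases h : x ∈ B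
    · exact Or.inr ⟨h, hx.2⟩
    · exact Or.inl ⟨hx.1, h⟩

lemma infinite_of_diff_finite {A B : Set ℕ} (hA : A.Infinite) (h : (A \ B).Finite) :
    B.Infinite :=
  (hA.sdiff h).mono fun x hx => by
    by_contra hB
    exact hx.2 ⟨hx.1, hB⟩

lemma hasPseudoIntersection_of_countable {F : Set (Set ℕ)} (hc : F.Countable)
    (hF : Centered F) : HasPseudoIntersection F := by
  classical
  rcases F.eq_empty_or_nonempty with rfl | hne
  · exact ⟨Set.univ, Set.infinite_univ, by simp⟩
  obtain ⟨A, rfl⟩ := hc.exists_eq_range hne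
  have hfreq : ∀ n, ∃ᶠ k in atTop, k ∈ ⋂ i ∈ Finset.range (n + 1), A i := fun n => by
    rw [Nat.frequently_atTop_iff_infinite]
    have := hF ((Finset.range (n + 1)).image A) (by
      intro B hB
      simp only [Finset.coe_image, Set.mem_image] at hB
      obtain ⟨i, -, rfl⟩ := hB
      exact ⟨i, rfl⟩)
    rw [Finset.set_biInter_finset_image] at this
    exact this
  obtain ⟨φ, hφ, hmem⟩ := extraction_forall_of_frequently hfreq
  refine ⟨Set.range φ, Set.infinite_range_of_injective hφ.injective, ?_⟩
  rintro _ ⟨i, rfl⟩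
  refine ((Set.finite_lt_nat i).image φ).subset ?_
  rintro _ ⟨⟨n, rfl⟩, hn⟩
  refine ⟨n, ?_, rfl⟩
  by_contra hi
  refine hn (Set.mem_iInter₂.1 (hmem n) i ?_)
  simp only [Set.mem_ofPred_eq, not_lt] at hi
  simp; omega

lemma exists_sparse_subset {P : Set ℕ} (hP : P.Infinite) (g : ℕ → ℕ) :
    ∃ E ⊆ P, E.Infinite ∧ ∀ a ∈ E, ∀ b ∈ E, a < b → ∀ n ≤ a, g n ≤ b := by
  obtain ⟨f, hfP, hf⟩ := exists_seq_of_forall_finset_exists (· ∈ P)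
    (fun x y => x < y ∧ ∀ n ≤ x, g n ≤ y) (fun s _ => by
      obtain ⟨y, hy, hlt⟩ := hP.exists_gt (s.sup id + ∑ n ∈ Finset.range (s.sup id + 1), g n)
      refine ⟨y, hy, fun x hx => ?_⟩
      have hxs : x ≤ s.sup id := Finset.le_sup (f := id) hx
      refine ⟨by omega, fun n hn => ?_⟩
      have : g n ≤ ∑ n ∈ Finset.range (s.sup id + 1), g n :=
        Finset.single_le_sum (f := g) (fun _ _ => Nat.zero_le _) (by simp; omega)
      omega)
  have hmono : StrictMono f := fun m n h => (hf m n h).1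
  refine ⟨Set.range f, ?_, Set.infinite_range_of_injective hmono.injective, ?_⟩
  · rintro _ ⟨n, rfl⟩
    exact hfP n
  · rintro _ ⟨m, rfl⟩ _ ⟨n, rfl⟩ hlt
    exact (hf m n (hmono.lt_iff_lt.1 hlt)).2

lemma exists_descending_seq {ι α : Type*} [LinearOrder ι] [WellFoundedLT ι] [Nonempty α]
    (Q : ι → α → Prop) (le : α → α → Prop)
    (step : ∀ i (f : ι → α), (∀ j < i, Q j (f j)) → (∀ j < i, ∀ k < j, le (f j) (f k)) →
      ∃ a, Q i a ∧ ∀ j < i, le a (f j)) :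
    ∃ f : ι → α, (∀ i, Q i (f i)) ∧ ∀ i, ∀ j < i, le (f i) (f j) := by
  classical
  let G : ∀ i : ι, (∀ j, j < i → α) → α := fun i g =>
    Classical.epsilon fun a => Q i a ∧ ∀ j (hj : j < i), le a (g j hj)
  let f : ι → α := (wellFounded_lt (α := ι)).fix G
  have hf : ∀ i, f i = Classical.epsilon fun a => Q i a ∧ ∀ j < i, le a (f j) :=
    fun i => WellFounded.fix_eq _ G i
  have key : ∀ i, Q i (f i) ∧ ∀ j < i, le (f i) (f j) := fun i => by
    induction i using WellFoundedLT.induction with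
    | ind i ih =>
      rw [hf i]
      exact Classical.epsilon_spec (p := fun a => Q i a ∧ ∀ j < i, le a (f j))
        (step i f (fun j hj => (ih j hj).1) fun j hj => (ih j hj).2)
  exact ⟨f, fun i => (key i).1, fun i => (key i).2⟩

lemma isAlmostChain_image {ι : Type*} [LinearOrder ι] {f : ι → Set ℕ} {s : Set ι}
    (hf : ∀ i ∈ s, ∀ j < i, (f i \ f j).Finite) : IsAlmostChain (f '' s) := by
  rintro _ ⟨i, hi, rfl⟩ _ ⟨j, hj, rfl⟩
  rcases lt_trichotomy i j with h | rfl | h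
  · exact Or.inr (hf j hj i h)
  · simp
  · exact Or.inl (hf i hi j h)

lemma IsAlmostChain.insert_univ {T : Set (Set ℕ)} (hT : IsAlmostChain T) :
    IsAlmostChain (insert Set.univ T) := by
  rintro A (rfl | hA) B (rfl | hB)
  · simp
  · simp
  · simp
  · exact hT A hA B hB

lemma IsAlmostChain.centered_union {D T : Set (Set ℕ)} (hT : IsAlmostChain T)
    (hDu : Set.univ ∈ D) (hTu : Set.univ ∈ T) (hD : ∀ A ∈ D, ∀ B ∈ D, A ∩ B ∈ D)
    (hpos : ∀ A ∈ T, ∀ B ∈ D, (A ∩ B).Infinite) : Centered (D ∪ T) := by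
  classical
  intro S hS
  suffices h : ∃ A ∈ T, ∃ B ∈ D, ((A ∩ B) \ ⋂ C ∈ S, C).Finite by
    obtain ⟨A, hA, B, hB, h⟩ := h
    exact infinite_of_diff_finite (hpos A hA B hB) h
  induction S using Finset.induction with
  | empty => exact ⟨_, hTu, _, hDu, by simp⟩
  | insert C S _ ih =>
    rw [Finset.coe_insert, Set.insert_subset_iff] at hS
    obtain ⟨A, hA, B, hB, h⟩ := ih hS.2
    rw [Finset.set_biInter_insert]
    rcases hS.1 with hC | hC
    · refine ⟨A, hA, B ∩ C, hD B hB C hC, h.subset ?_⟩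
      rintro x ⟨⟨h1, h2, h3⟩, h4⟩
      exact ⟨⟨h1, h2⟩, fun h5 => h4 ⟨h3, h5⟩⟩
    · rcases hT A hA C hC with hAC | hCA
      · refine ⟨A, hA, B, hB, (h.union hAC).subset ?_⟩
        rintro x ⟨⟨h1, h2⟩, h3⟩
        by_cases hx : x ∈ C
        · exact Or.inl ⟨⟨h1, h2⟩, fun h5 => h3 ⟨hx, h5⟩⟩
        · exact Or.inr ⟨h1, hx⟩
      · refine ⟨C, hC, B, hB, (h.union hCA).subset ?_⟩
        rintro x ⟨⟨h1, h2⟩, h3⟩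
        by_cases hx : x ∈ A
        · exact Or.inl ⟨⟨hx, h2⟩, fun h5 => h3 ⟨h1, h5⟩⟩
        · exact Or.inr ⟨h1, hx⟩

lemma IsAlmostChain.centered {T : Set (Set ℕ)} (hT : IsAlmostChain T)
    (hinf : ∀ A ∈ T, A.Infinite) : Centered T := fun S hS =>
  hT.insert_univ.centered_union (D := {Set.univ}) rfl (Or.inl rfl) (by simp) (by
    rintro A (rfl | hA) B rfl
    · simpa using Set.infinite_univ
    · simpa using hinf A hA) S fun A hA => Or.inr (Or.inr (hS hA))

variable {κ : Cardinal.{0}}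

lemma IsAlmostChain.hasPseudoIntersection
    (hκ : ∀ F : Set (Set ℕ), #F ≤ κ → Centered F → HasCountablePiNetwork F)
    {T : Set (Set ℕ)} (hT : IsAlmostChain T) (hinf : ∀ A ∈ T, A.Infinite) (hcard : #T ≤ κ) :
    HasPseudoIntersection T := by
  have hc := hT.centered hinf
  obtain ⟨A, hA, hAT⟩ := hκ T hcard hc
  by_cases h : ∃ n, ∀ B ∈ T, (A n \ B).Finite
  · obtain ⟨n, hn⟩ := h
    exact ⟨A n, hA n, hn⟩
  push Not at h
  choose t htT ht using h
  have htT' : Set.range t ⊆ T := Set.range_subset_iff.2 htT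
  obtain ⟨P, hP, hPt⟩ := hasPseudoIntersection_of_countable (Set.countable_range t)
    fun S hS => hc S (hS.trans htT')
  refine ⟨P, hP, fun B hB => ?_⟩
  obtain ⟨n, hn⟩ := hAT {B} (by simpa using hB)
  have hnB : A n ⊆ B := by simpa using hn
  rcases hT _ (htT n) B hB with h | h
  · exact diff_finite_trans (hPt _ ⟨n, rfl⟩) h
  · exact absurd (h.subset (Set.sdiff_subset_sdiff_left hnB)) (ht n)

lemma exists_eventually_bound
    (hκ : ∀ F : Set (Set ℕ), #F ≤ κ → Centered F → HasCountablePiNetwork F)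
    {ι : Type} (hι : #ι ≤ κ) (g : ι → ℕ → ℕ) :
    ∃ h : ℕ → ℕ, ∀ i, ∀ᶠ n in atTop, g i n ≤ h n := by
  classical
  obtain ⟨_, _⟩ := exists_wellFoundedLT ι
  obtain ⟨f, hf, hdesc⟩ := exists_descending_seq (ι := ι)
    (fun i E => E.Infinite ∧ ∀ a ∈ E, ∀ b ∈ E, a < b → ∀ n ≤ a, g i n ≤ b)
    (fun A B : Set ℕ => (A \ B).Finite) (fun i f hQ hle => by
      obtain ⟨P, hP, hPf⟩ := (isAlmostChain_image (s := Set.Iio i) hle).hasPseudoIntersection hκ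
        (by rintro _ ⟨j, hj, rfl⟩; exact (hQ j hj).1)
        ((mk_image_le.trans (mk_set_le _)).trans hι)
      obtain ⟨E, hEP, hE, hs⟩ := exists_sparse_subset hP (g i)
      exact ⟨E, ⟨hE, hs⟩, fun j hj =>
        (hPf _ ⟨j, hj, rfl⟩).subset (Set.sdiff_subset_sdiff_left hEP)⟩)
  obtain ⟨P, hP, hPf⟩ := (isAlmostChain_image (s := Set.univ) fun i _ => hdesc i
    ).hasPseudoIntersection hκ (by rintro _ ⟨j, -, rfl⟩; exact (hf j).1)
      ((mk_image_le.trans (mk_set_le _)).trans hι)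
  choose u huP hu using fun n => hP.exists_gt n
  refine ⟨fun n => u (u n), fun i => ?_⟩
  obtain ⟨N, hN⟩ := (hPf _ ⟨i, trivial, rfl⟩).bddAbove
  filter_upwards [eventually_ge_atTop N] with n hn
  have hmem : ∀ m, N ≤ m → u m ∈ f i := fun m hm => by
    by_contra hx
    have h1 : u m ≤ N := hN ⟨huP m, hx⟩
    have h2 := hu m
    omega
  exact (hf i).2 _ (hmem n hn) _ (hmem _ (hn.trans (hu n).le)) (hu _) n (hu n).le

lemma exists_positive_pseudoIntersection (hω : ℵ₀ ≤ κ)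
    (hκ : ∀ F : Set (Set ℕ), #F ≤ κ → Centered F → HasCountablePiNetwork F)
    {D T : Set (Set ℕ)} (hDκ : #D ≤ κ) (hTκ : #T ≤ κ) (hT : IsAlmostChain T)
    (hDu : Set.univ ∈ D) (hTu : Set.univ ∈ T) (hD : ∀ A ∈ D, ∀ B ∈ D, A ∩ B ∈ D)
    (hpos : ∀ A ∈ T, ∀ B ∈ D, (A ∩ B).Infinite) :
    ∃ A : Set ℕ, (∀ B ∈ D, (A ∩ B).Infinite) ∧ ∀ B ∈ T, (A \ B).Finite := by
  classical
  obtain ⟨A, hA, hADT⟩ := hκ (D ∪ T) ((mk_union_le _ _).trans (add_le_of_le hω hDκ hTκ))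
    (hT.centered_union hDu hTu hD hpos)
  replace hADT : ∀ B ∈ D, ∀ C ∈ T, ∃ n, A n ⊆ B ∧ A n ⊆ C := fun B hB C hC => by
    obtain ⟨n, hn⟩ := hADT {B, C} (by
      intro x hx
      simp only [Finset.coe_insert, Finset.coe_singleton, Set.mem_insert_iff,
        Set.mem_singleton_iff] at hx
      rcases hx with rfl | rfl
      · exact Or.inl hB
      · exact Or.inr hC)
    exact ⟨n, by simpa using hn⟩
  have ht : ∀ n, ∃ C ∈ T, (A n \ C).Finite → ∀ B ∈ T, (A n \ B).Finite := fun n => by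
    by_cases h : ∀ B ∈ T, (A n \ B).Finite
    · exact ⟨_, hTu, fun _ => h⟩
    · push Not at h
      obtain ⟨B, hB, hAB⟩ := h
      exact ⟨B, hB, fun h => absurd h hAB⟩
  choose t htT ht using ht
  by_cases hcoin : ∃ C ∈ T, ∀ n, (C \ t n).Finite
  · obtain ⟨C, hC, hCt⟩ := hcoin
    let N : Set ℕ := {n | ∀ B ∈ T, (A n \ B).Finite}
    have hg : ∀ (B : T) (n : ℕ), ∃ m, n ∈ N → ∀ x ∈ A n, m ≤ x → x ∈ B.1 := fun B n => by
      by_cases hn : n ∈ N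
      · obtain ⟨m, hm⟩ := (hn B.1 B.2).bddAbove
        refine ⟨m + 1, fun _ x hx hmx => ?_⟩
        by_contra hxB
        have : x ≤ m := hm ⟨hx, hxB⟩
        omega
      · exact ⟨0, fun h => absurd h hn⟩
    choose g hg using hg
    obtain ⟨h, hh⟩ := exists_eventually_bound hκ hTκ g
    refine ⟨⋃ n ∈ N, A n ∩ Set.Ici (h n), fun B hB => ?_, fun B hB => ?_⟩
    · obtain ⟨n, hnB, hnC⟩ := hADT B hB C hC
      have hnN : n ∈ N := ht n ((hCt n).subset (Set.sdiff_subset_sdiff_left hnC))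
      refine ((hA n).sdiff (Set.finite_lt_nat (h n))).mono ?_
      rintro x ⟨hx, hxh⟩
      exact ⟨Set.mem_biUnion hnN ⟨hx, by simpa using hxh⟩, hnB hx⟩
    · obtain ⟨n₀, hn₀⟩ := eventually_atTop.1 (hh ⟨B, hB⟩)
      refine (((Set.finite_lt_nat n₀).inter_of_left N).biUnion
        (t := fun n => A n \ B) fun n hn => hn.2 B hB).subset ?_
      rintro x ⟨hx, hxB⟩
      obtain ⟨n, hnN, hxA, hxh⟩ := Set.mem_iUnion₂.1 hx
      refine Set.mem_biUnion ⟨?_, hnN⟩ ⟨hxA, hxB⟩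
      by_contra hn
      exact hxB (hg ⟨B, hB⟩ n hnN x hxA ((hn₀ n (not_lt.1 hn)).trans hxh))
  · push Not at hcoin
    let E : ℕ → Set ℕ := fun k => ⋂ i ∈ Finset.range (k + 1), t i
    have hmin : ∀ k, ∃ C ∈ T, (C \ E k).Finite := fun k => by
      induction k with
      | zero => exact ⟨t 0, htT 0, by simp [E]⟩
      | succ k ih =>
        obtain ⟨C, hC, hCE⟩ := ih
        have hE : E (k + 1) = t (k + 1) ∩ E k := by
          simp only [E]
          rw [Finset.range_add_one (n := k + 1), Finset.set_biInter_insert]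
        rw [hE]
        rcases hT C hC _ (htT (k + 1)) with h | h
        · refine ⟨C, hC, ?_⟩
          rw [Set.sdiff_inter]
          exact h.union hCE
        · refine ⟨_, htT (k + 1), ?_⟩
          rw [Set.sdiff_inter]
          exact Set.Finite.union (by simp) (diff_finite_trans h hCE)
    have hEinf : ∀ B ∈ D, ∀ k, (E k ∩ B).Infinite := fun B hB k => by
      obtain ⟨C, hC, hCE⟩ := hmin k
      refine infinite_of_diff_finite (hpos C hC B hB) (hCE.subset ?_)
      rintro x ⟨⟨h1, h2⟩, h3⟩
      exact ⟨h1, fun h => h3 ⟨h, h2⟩⟩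
    choose g hgE hg using fun (B : D) k => (hEinf B.1 B.2 k).exists_gt k
    obtain ⟨h, hh⟩ := exists_eventually_bound hκ hDκ g
    refine ⟨{x | ∃ k, x ∈ E k ∧ x ≤ h k}, fun B hB => ?_, fun B hB => ?_⟩
    · obtain ⟨n₀, hn₀⟩ := eventually_atTop.1 (hh ⟨B, hB⟩)
      refine Set.infinite_of_forall_exists_gt fun m => ?_
      have hm := hg ⟨B, hB⟩ (max m n₀)
      exact ⟨g ⟨B, hB⟩ (max m n₀), ⟨⟨_, (hgE _ _).1, hn₀ _ (le_max_right _ _)⟩, (hgE ⟨B, hB⟩ _).2⟩,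
        (le_max_left _ _).trans_lt hm⟩
    · obtain ⟨n, hn⟩ := hcoin B hB
      have hnB : (t n \ B).Finite := (hT B hB _ (htT n)).resolve_left hn
      refine diff_finite_trans (B := t n) ?_ hnB
      refine ((Set.finite_lt_nat n).biUnion (t := fun k => Set.Iic (h k))
        fun k _ => Set.finite_Iic _).subset ?_
      rintro x ⟨⟨k, hxE, hxh⟩, hxt⟩
      refine Set.mem_biUnion ?_ hxh
      by_contra hk
      simp only [Set.mem_ofPred_eq, not_lt] at hk
      exact hxt (Set.mem_iInter₂.1 hxE n (by simp; omega))

theorem Centered.hasPseudoIntersection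
    (hκ : ∀ F : Set (Set ℕ), #F ≤ κ → Centered F → HasCountablePiNetwork F)
    {F : Set (Set ℕ)} (hFκ : #F ≤ κ) (hF : Centered F) : HasPseudoIntersection F := by
  classical
  by_cases hc : F.Countable
  · exact hasPseudoIntersection_of_countable hc hF
  have hFω : ℵ₀ ≤ #F := (not_le.1 fun h => hc (le_aleph0_iff_set_countable.1 h)).le
  have : Infinite F := infinite_iff.2 hFω
  let I : Finset F → Set ℕ := fun S => ⋂ A ∈ S, A.1
  have hI : ∀ S, (I S).Infinite := fun S => by
    have := hF (S.image Subtype.val) (by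
      intro A hA
      simp only [Finset.coe_image, Set.mem_image] at hA
      obtain ⟨A, -, rfl⟩ := hA
      exact A.2)
    rwa [Finset.set_biInter_finset_image] at this
  have hDκ : #(Set.range I) ≤ κ := mk_range_le.trans ((mk_finset_of_infinite F).le.trans hFκ)
  have hinter : ∀ A ∈ Set.range I, ∀ B ∈ Set.range I, A ∩ B ∈ Set.range I := by
    rintro _ ⟨S, rfl⟩ _ ⟨S', rfl⟩
    exact ⟨S ∪ S', by ext x; simp [I, or_imp, forall_and]⟩
  have hDu : Set.univ ∈ Set.range I := ⟨∅, by simp [I]⟩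
  have hsub : ∀ A ∈ F, A ∈ Set.range I := fun A hA => ⟨{⟨A, hA⟩}, by
    simp only [I, Finset.mem_singleton, Set.iInter_iInter_eq_left]⟩
  obtain ⟨ι, G, hι, rfl⟩ : ∃ (ι : Type) (G : ι → Set ℕ), #ι ≤ κ ∧ Set.range G = F :=
    ⟨F, Subtype.val, hFκ, Subtype.range_coe⟩
  obtain ⟨_, _⟩ := exists_wellFoundedLT ι
  obtain ⟨f, hf, hdesc⟩ := exists_descending_seq (ι := ι)
    (fun i E => (∀ B ∈ Set.range I, (E ∩ B).Infinite) ∧ E ⊆ G i)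
    (fun A B : Set ℕ => (A \ B).Finite) (fun i f hQ hle => by
      obtain ⟨A, hA, hAf⟩ := exists_positive_pseudoIntersection (hFω.trans hFκ) hκ hDκ
        (T := insert Set.univ (f '' Set.Iio i))
        (mk_insert_le.trans (add_le_of_le (hFω.trans hFκ)
          ((mk_image_le.trans (mk_set_le _)).trans hι)
          (one_le_aleph0.trans (hFω.trans hFκ))))
        (isAlmostChain_image (s := Set.Iio i) hle).insert_univ hDu (Or.inl rfl) hinter (by
          rintro _ (rfl | ⟨j, hj, rfl⟩) B hB
          · obtain ⟨S, rfl⟩ := hB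
            simpa using hI S
          · exact (hQ j hj).1 B hB)
      refine ⟨A ∩ G i, ⟨fun B hB => ?_, Set.inter_subset_right⟩, fun j hj =>
        (hAf _ (Or.inr ⟨j, hj, rfl⟩)).subset (Set.sdiff_subset_sdiff_left Set.inter_subset_left)⟩
      rw [Set.inter_assoc]
      exact hA _ (hinter _ (hsub _ ⟨i, rfl⟩) _ hB))
  obtain ⟨P, hP, hPf⟩ := (isAlmostChain_image (s := Set.univ) fun i _ => hdesc i
    ).hasPseudoIntersection hκ (by
      rintro _ ⟨j, -, rfl⟩
      simpa using (hf j).1 _ hDu)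
    ((mk_image_le.trans (mk_set_le _)).trans hι)
  refine ⟨P, hP, ?_⟩
  rintro _ ⟨i, rfl⟩
  exact (hPf _ ⟨i, trivial, rfl⟩).subset (Set.sdiff_subset_sdiff_right (hf i).2)

end Combinatorics

section FunctionSpace

open Filter Topology

/-- The basic neighborhood of `f` in `Cp X` given by the finite set `S` and the radius
`1 / (k + 1)`. -/
def Cp.basicNhd {X : Set ℝ} (f : Cp X) (S : Set X) (k : ℕ) : Set (Cp X) :=
  {g | ∀ x ∈ S, |g.1 x - f.1 x| < 1 / ((k : ℝ) + 1)}

instance (X : Set ℝ) : T2Space (Cp X) :=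
  inferInstanceAs (T2Space {f : X → ℝ // Continuous f})

lemma Cp.continuous_eval {X : Set ℝ} (x : X) : Continuous fun g : Cp X => g.1 x :=
  (continuous_apply x).comp (continuous_subtype_val (p := fun f : X → ℝ => Continuous f))

lemma Cp.basicNhd_mem_nhds {X : Set ℝ} (f : Cp X) {S : Set X} (hS : S.Finite) (k : ℕ) :
    f.basicNhd S k ∈ 𝓝 f := by
  refine (hS.eventually_all (l := 𝓝 f)
    (p := fun x g => |g.1 x - f.1 x| < 1 / ((k : ℝ) + 1))).2 fun x _ => ?_
  have hc : Continuous fun g : Cp X => |g.1 x - f.1 x| :=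
    ((Cp.continuous_eval x).sub continuous_const).abs
  exact hc.continuousAt.eventually_lt continuousAt_const (by simp; positivity)

lemma Cp.exists_basicNhd_subset {X : Set ℝ} {f : Cp X} {U : Set (Cp X)} (hU : U ∈ 𝓝 f) :
    ∃ S : Finset X, ∃ k, f.basicNhd S k ⊆ U := by
  obtain ⟨V, hV, hVU⟩ := mem_nhds_induced (Subtype.val : Cp X → X → ℝ) f U |>.1 hU
  rw [nhds_pi, Filter.mem_pi'] at hV
  obtain ⟨S, t, ht, htV⟩ := hV
  have hk : ∀ x, ∃ k : ℕ, ∀ y, |y - f.1 x| < 1 / ((k : ℝ) + 1) → y ∈ t x := fun x => by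
    obtain ⟨ε, hε, hb⟩ := Metric.mem_nhds_iff.1 (ht x)
    obtain ⟨k, hk⟩ := exists_nat_one_div_lt hε
    exact ⟨k, fun y hy => hb (by rw [Metric.mem_ball, Real.dist_eq]; exact hy.trans hk)⟩
  choose k hk using hk
  refine ⟨S, S.sup k, fun g hg => hVU (htV fun x hx => hk x _ ((hg x hx).trans_le ?_))⟩
  exact Nat.one_div_le_one_div (Finset.le_sup (f := k) hx)

lemma Cp.exists_countable_subset_mem_closure {X : Set ℝ} {f : Cp X} {B : Set (Cp X)}
    (hf : f ∈ closure B) : ∃ C ⊆ B, C.Countable ∧ f ∈ closure C := by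
  have hg : ∀ (n k : ℕ) (v : Fin n → X), ∃ g ∈ B, g ∈ f.basicNhd (Set.range v) k :=
    fun n k v => by
      obtain ⟨g, h1, h2⟩ := mem_closure_iff_nhds.1 hf _
        (f.basicNhd_mem_nhds (Set.finite_range v) k)
      exact ⟨g, h2, h1⟩
  choose g hgB hg using hg
  have hs : ∀ n k, ∃ s : Set (Fin n → X), s.Countable ∧
      ⋃ v ∈ s, {w | g n k v ∈ f.basicNhd (Set.range w) k} = Set.univ := fun n k => by
    refine TopologicalSpace.countable_cover_nhds fun v => ?_
    have : ∀ i : Fin n, ∀ᶠ w : Fin n → X in 𝓝 v,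
        |(g n k v).1 (w i) - f.1 (w i)| < 1 / ((k : ℝ) + 1) := fun i => by
      have hc : Continuous fun w : Fin n → X => |(g n k v).1 (w i) - f.1 (w i)| :=
        (((g n k v).2.comp (continuous_apply i)).sub (f.2.comp (continuous_apply i))).abs
      exact hc.continuousAt.eventually_lt continuousAt_const (hg n k v _ ⟨i, rfl⟩)
    filter_upwards [eventually_all.2 this] with w hw
    rintro _ ⟨i, rfl⟩
    exact hw i
  choose s hsc hs using hs
  refine ⟨⋃ n, ⋃ k, g n k '' s n k, ?_, ?_, ?_⟩
  · simp only [Set.iUnion_subset_iff, Set.image_subset_iff]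
    exact fun n k v _ => hgB n k v
  · exact Set.countable_iUnion fun n => Set.countable_iUnion fun k => (hsc n k).image _
  · refine mem_closure_iff_nhds.2 fun U hU => ?_
    obtain ⟨S, k, hSU⟩ := Cp.exists_basicNhd_subset hU
    let w : Fin S.card → X := fun i => (S.equivFin.symm i).1
    have hw : Set.range w = S := by
      ext x
      constructor
      · rintro ⟨i, rfl⟩
        exact (S.equivFin.symm i).2
      · exact fun hx => ⟨S.equivFin ⟨x, hx⟩, by simp [w]⟩
    obtain ⟨v, hv, hvw⟩ := Set.mem_iUnion₂.1 ((hs _ k).symm ▸ Set.mem_univ w)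
    refine ⟨g _ k v, hSU ?_, Set.mem_iUnion₂.2 ⟨_, k, v, hv, rfl⟩⟩
    rw [← hw]
    exact hvw

lemma infinite_inter_of_mem_closure {Y : Type*} [TopologicalSpace Y] [T1Space Y] {y : Y}
    {C U : Set Y} (hy : y ∈ closure C) (hyC : y ∉ C) (hU : U ∈ 𝓝 y) : (U ∩ C).Infinite := by
  intro hfin
  have hV : (U ∩ C)ᶜ ∈ 𝓝 y := hfin.isClosed.isOpen_compl.mem_nhds fun h => hyC h.2
  obtain ⟨z, ⟨h1, h2⟩, h3⟩ := mem_closure_iff_nhds.1 hy _ (inter_mem hU hV)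
  exact h2 ⟨h1, h3⟩

/-- If small centered families have pseudo-intersections, then `Cp X` has the Pytkeev property
for small `X`. -/
lemma pytkeevProperty_cp {X : Set ℝ}
    (hX : ∀ F : Set (Set ℕ), #F ≤ #X → Centered F → HasPseudoIntersection F) :
    PytkeevProperty (Cp X) := by
  classical
  intro f A hf
  obtain ⟨C, hCA, hC, hfC⟩ := Cp.exists_countable_subset_mem_closure hf
  have hfnC : f ∉ C := fun h => (hCA h).2 rfl
  have hCinf : C.Infinite := by
    simpa using infinite_inter_of_mem_closure hfC hfnC univ_mem
  have := hC.to_subtype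
  have := hCinf.to_subtype
  obtain ⟨_⟩ := nonempty_denumerable C
  let e : ℕ → Cp X := fun n => ((Denumerable.eqv C).symm n).1
  have he : Function.Injective e := Subtype.val_injective.comp (Equiv.injective _)
  have hrange : Set.range e = C := by
    simp only [e]
    rw [Set.range_comp' Subtype.val, (Equiv.surjective _).range_eq]
    simp
  let F : Set (Set ℕ) := Set.range fun p : X × ℕ => e ⁻¹' f.basicNhd {p.1} p.2
  have hinf : ∀ s ∈ comap e (𝓝 f), s.Infinite := by
    rintro s ⟨U, hU, hUs⟩
    refine Set.Infinite.mono hUs (Set.Infinite.of_image e ?_)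
    rw [Set.image_preimage_eq_inter_range, hrange]
    exact infinite_inter_of_mem_closure hfC hfnC hU
  have hF : Centered F := fun S hS => hinf _ ((biInter_finset_mem S).2 fun s hs => by
    obtain ⟨p, rfl⟩ := hS hs
    exact preimage_mem_comap (f.basicNhd_mem_nhds (Set.finite_singleton _) _))
  have hFP : HasPseudoIntersection F := by
    by_cases hc : X.Countable
    · have := hc.to_subtype
      exact hasPseudoIntersection_of_countable (Set.countable_range _) hF
    · have hXω : ℵ₀ ≤ #X := (not_le.1 fun h => hc (le_aleph0_iff_set_countable.1 h)).le
      refine hX F (mk_range_le.trans ?_) hF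
      rw [mk_prod, lift_id, lift_id, mk_nat, mul_aleph0_eq hXω]
  obtain ⟨P, hP, hPF⟩ := hFP
  refine ⟨fun n => e '' (P ∩ Set.Ici n), fun n => ⟨?_, ?_⟩, fun U hU => ?_⟩
  · refine Set.Infinite.image he.injOn ((hP.sdiff (Set.finite_lt_nat n)).mono ?_)
    rintro x ⟨hx, hxn⟩
    exact ⟨hx, by simpa using hxn⟩
  · rintro _ ⟨m, -, rfl⟩
    exact (hCA (hrange ▸ Set.mem_range_self m)).1
  · obtain ⟨S, k, hSU⟩ := Cp.exists_basicNhd_subset hU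
    have hfin : (⋃ x ∈ S, P \ e ⁻¹' f.basicNhd {x} k).Finite :=
      S.finite_toSet.biUnion fun x _ => hPF _ ⟨(x, k), rfl⟩
    obtain ⟨n, hn⟩ := hfin.bddAbove
    refine ⟨n + 1, ?_⟩
    rintro _ ⟨m, ⟨hmP, hmn⟩, rfl⟩
    refine hSU fun x hx => ?_
    by_contra hlt
    have : m ≤ n := hn (Set.mem_iUnion₂.2 ⟨x, hx, hmP, fun h => hlt (h x rfl)⟩)
    simp only [Set.mem_Ici] at hmn
    omega

/-- Sets of natural numbers can be coded by reals so that membership of each number is decided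
by a continuous function of the code. -/
lemma exists_continuous_mem_indicator :
    ∃ (φ : Set ℕ → ℝ) (g : ℕ → Cp (Set.range φ)),
      ∀ m A, (m ∈ A → (g m).1 ⟨φ A, A, rfl⟩ = 0) ∧ (m ∉ A → (g m).1 ⟨φ A, A, rfl⟩ = 1) := by
  classical
  let H := cantorSetHomeomorphNatToBool
  let φ : Set ℕ → ℝ := fun A => (H.symm fun n => decide (n ∈ A)).1
  have hφ : Set.range φ ⊆ cantorSet := by
    rintro _ ⟨A, rfl⟩
    exact Subtype.coe_prop _
  let b : Bool → ℝ := fun b => if b then 0 else 1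
  refine ⟨φ, fun m => ⟨fun y => b (H (Set.inclusion hφ y) m), ?_⟩, fun m A => ?_⟩
  · exact (continuous_of_discreteTopology (f := b)).comp
      ((continuous_apply m).comp (H.continuous.comp (continuous_inclusion hφ)))
  · have h : H (Set.inclusion hφ ⟨φ A, A, rfl⟩) = fun n => decide (n ∈ A) :=
      H.apply_symm_apply _
    simp only [h, b]
    exact ⟨fun hm => by simp [hm], fun hm => by simp [hm]⟩

/-- If `Cp X` has the Pytkeev property for all small `X`, then small centered families have
countable π-networks of infinite sets. -/
lemma Centered.hasCountablePiNetwork {κ : Cardinal.{0}}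
    (hκ : ∀ X : Set ℝ, #X ≤ κ → PytkeevProperty (Cp X)) {F : Set (Set ℕ)} (hFκ : #F ≤ κ)
    (hF : Centered F) : HasCountablePiNetwork F := by
  classical
  by_cases hfree : (⋂ A ∈ F, A).Infinite
  · exact ⟨fun _ => ⋂ A ∈ F, A, fun _ => hfree, fun S hS =>
      ⟨0, Set.biInter_mono hS fun _ _ => le_rfl⟩⟩
  obtain ⟨φ, g, hg⟩ := exists_continuous_mem_indicator
  let X : Set ℝ := φ '' F
  let ι : X → Set.range φ := Set.inclusion (Set.image_subset_range φ F)
  let G : ℕ → Cp X := fun m => ⟨(g m).1 ∘ ι, (g m).2.comp (continuous_inclusion _)⟩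
  let z : Cp X := ⟨fun _ => 0, continuous_const⟩
  have hG0 : ∀ m (A : Set ℕ) (hA : A ∈ F), m ∈ A → (G m).1 ⟨φ A, A, hA, rfl⟩ = 0 :=
    fun m A _ => (hg m A).1
  have hG1 : ∀ m (A : Set ℕ) (hA : A ∈ F), m ∉ A → (G m).1 ⟨φ A, A, hA, rfl⟩ = 1 :=
    fun m A _ => (hg m A).2
  have hz : z ∈ closure (Set.range G \ {z}) := by
    refine mem_closure_iff_nhds.2 fun U hU => ?_
    obtain ⟨S, k, hSU⟩ := Cp.exists_basicNhd_subset hU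
    choose a haF ha using fun x : X => x.2
    obtain ⟨m, hmS, hm⟩ := (hF (S.image a) (by
      intro A hA
      simp only [Finset.coe_image, Set.mem_image] at hA
      obtain ⟨x, -, rfl⟩ := hA
      exact haF x)).exists_notMem_finite (Set.not_infinite.1 hfree)
    refine ⟨G m, hSU fun x hx => ?_, ⟨m, rfl⟩, fun hGz => ?_⟩
    · have h0 := hG0 m (a x) (haF x) (Set.mem_iInter₂.1 hmS _ (Finset.mem_image_of_mem a hx))
      have hx' : (⟨φ (a x), a x, haF x, rfl⟩ : X) = x := Subtype.ext (ha x)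
      rw [hx'] at h0
      rw [h0]
      simp only [z, sub_zero, abs_zero]
      positivity
    · simp only [Set.mem_iInter, not_forall] at hm
      obtain ⟨A, hA, hmA⟩ := hm
      have h1 := hG1 m A hA hmA
      rw [Set.mem_singleton_iff.1 hGz] at h1
      exact zero_ne_one h1
  obtain ⟨As, hAs, hU⟩ := hκ X (mk_image_le.trans hFκ) z (Set.range G) hz
  refine ⟨fun n => G ⁻¹' As n, fun n => (hAs n).1.preimage (hAs n).2, fun S hS => ?_⟩
  let S' : Set X := {x | x.1 ∈ φ '' S}
  have hS' : S'.Finite := (S.finite_toSet.image φ).preimage Subtype.val_injective.injOn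
  obtain ⟨n, hn⟩ := hU _ (z.basicNhd_mem_nhds hS' 0)
  refine ⟨n, fun m hm => Set.mem_iInter₂.2 fun A hA => ?_⟩
  by_contra hmA
  have h1 := hn hm ⟨φ A, A, hS hA, rfl⟩ ⟨A, hA, rfl⟩
  rw [hG1 m A (hS hA) hmA] at h1
  simp [z] at h1

end FunctionSpace

/-- The minimal cardinality of a set of reals `X` such that `C_p(X)` does not have the
Pytkeev property equals the pseudo-intersection number 𝔭. -/
theorem min_card_cp_not_pytkeev_eq_p :
    sInf {c : Cardinal | ∃ X : Set ℝ, #X = c ∧ ¬ PytkeevProperty (Cp X)} =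
      pseudoIntersectionNumber := by
  unfold pseudoIntersectionNumber
  have hle : ∀ s t : Set Cardinal.{0}, (∀ c ∈ s, ∃ d ∈ t, d ≤ c) → t.Nonempty → s.Nonempty →
      sInf t ≤ sInf s := fun s t h _ hs => by
    obtain ⟨d, hd, hdc⟩ := h _ (csInf_mem hs)
    exact (csInf_le' hd).trans hdc
  have heq : ∀ s t : Set Cardinal.{0}, (∀ c ∈ s, ∃ d ∈ t, d ≤ c) →
      (∀ c ∈ t, ∃ d ∈ s, d ≤ c) → sInf s = sInf t := fun s t hst hts => by
    rcases s.eq_empty_or_nonempty with rfl | hs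
    · rcases t.eq_empty_or_nonempty with rfl | ⟨c, hc⟩
      · rfl
      · obtain ⟨d, hd, -⟩ := hts c hc
        exact hd.elim
    · obtain ⟨c, hc⟩ := id hs
      obtain ⟨d, hd, -⟩ := hst c hc
      exact le_antisymm (hle t s hts hs ⟨d, hd⟩) (hle s t hst ⟨d, hd⟩ hs)
  refine heq _ _ ?_ ?_
  · rintro _ ⟨X, rfl, hX⟩
    by_contra h
    refine hX (pytkeevProperty_cp fun F hFX hF => ?_)
    by_contra hP
    refine h ⟨#F, ⟨F, rfl, fun A hA => ?_, hF, hP⟩, hFX⟩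
    simpa using hF {A} (by simpa using hA)
  · rintro _ ⟨F, rfl, -, hF, hP⟩
    by_contra! h
    refine hP (Centered.hasPseudoIntersection (κ := #F) (fun F' hF' hc =>
      hc.hasCountablePiNetwork (fun X hX => ?_) hF') le_rfl hF)
    by_contra hXP
    exact (h #X ⟨X, rfl, hXP⟩).not_ge hX
end

section
/- For every uncountable regular cardinal λ there exists a zero-dimensional Hausdorff (hence Tychonoff) topological space which is μ-resolvable for all cardinals μ < λ, but not λ-resolvable. -/
open Cardinal

/-- A space is `κ`-resolvable if it contains `κ` pairwise disjoint dense subsets. -/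
def Resolvable (X : Type*) [TopologicalSpace X] (κ : Cardinal) : Prop :=
  ∃ D : Set (Set X), #D = κ ∧ (∀ d ∈ D, Dense d) ∧ D.PairwiseDisjoint id

/-- `Δ(X)`: the minimum cardinality of a nonempty open subset of `X`. -/
noncomputable def Delta (X : Type*) [TopologicalSpace X] : Cardinal :=
  sInf {c : Cardinal | ∃ U : Set X, IsOpen U ∧ U.Nonempty ∧ #U = c}

/-- `X` is maximally resolvable if it is `Δ(X)`-resolvable. -/
def MaximallyResolvable (X : Type*) [TopologicalSpace X] : Prop :=
  Resolvable X (Delta X)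

/-- A space is zero-dimensional if it has a base of clopen sets. -/
def ZeroDimensional (X : Type*) [TopologicalSpace X] : Prop :=
  ∀ (x : X) (U : Set X), IsOpen U → x ∈ U → ∃ V : Set X, IsClopen V ∧ x ∈ V ∧ V ⊆ U

open Set in
/-- Among `lam` many finite partial functions with domains of size at most `n` and fewer than
`lam` values at each point, two are compatible. -/
theorem exists_ne_agree_of_card_le {ι J : Type} {V : J → Type} {lam : Cardinal.{0}}
    (hreg : lam.IsRegular) (hV : ∀ j, #(V j) < lam) (v : ι → ∀ j, V j) (n : ℕ) :
    ∀ (p : ι → Finset J) (A : Set ι), lam ≤ #A → (∀ a ∈ A, (p a).card ≤ n) →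
      ∃ a ∈ A, ∃ b ∈ A, a ≠ b ∧ ∀ j ∈ p a, j ∈ p b → v a j = v b j := by
  classical
  have hcof : ∀ {c : Cardinal.{0}}, c < lam → c < lam.ord.cof := fun h ↦ by rwa [hreg.cof_ord]
  induction n with
  | zero =>
    intro p A hA hp
    have hone : (1 : Cardinal) < #A := (one_lt_aleph0.trans_le hreg.aleph0_le).trans_le hA
    obtain ⟨a, b, hab⟩ := one_lt_iff_nontrivial.1 hone
    refine ⟨a, a.2, b, b.2, fun h ↦ hab (Subtype.ext h), fun j hj ↦ ?_⟩
    have := hp a a.2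
    simp_all
  | succ n ih =>
    intro p A hA hp
    by_cases h : ∃ j, lam ≤ #{a | a ∈ A ∧ j ∈ p a}
    · obtain ⟨j, hj⟩ := h
      obtain ⟨x, B, hBs, hB, hx⟩ := infinite_pigeonhole_set (s := {a | a ∈ A ∧ j ∈ p a})
        (fun a ↦ v a j) lam hj hreg.aleph0_le (hcof (hV j))
      obtain ⟨a, ha, b, hb, hab, H⟩ := ih (fun a ↦ (p a).erase j) B hB (fun a ha ↦ by
        have h1 := hp a (hBs ha).1
        rw [Finset.card_erase_of_mem (hBs ha).2]
        omega)
      refine ⟨a, (hBs ha).1, b, (hBs hb).1, hab, fun k hka hkb ↦ ?_⟩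
      by_cases hk : k = j
      · subst hk
        exact (hx ha).trans (hx hb).symm
      · exact H k (Finset.mem_erase.2 ⟨hk, hka⟩) (Finset.mem_erase.2 ⟨hk, hkb⟩)
    · push Not at h
      have hne : #A ≠ 0 := (hreg.pos.trans_le hA).ne'
      obtain ⟨a, ha⟩ := nonempty_coe_sort.1 (mk_ne_zero_iff.1 hne)
      have hU : #(⋃ j : p a, {b | b ∈ A ∧ (j : J) ∈ p b}) < lam :=
        (card_iUnion_lt_iff_forall_of_isRegular hreg
          ((lt_aleph0_of_finite _).trans_le hreg.aleph0_le)).2 fun j ↦ h j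
      have hU' : #(insert a (⋃ j : p a, {b | b ∈ A ∧ (j : J) ∈ p b}) : Set ι) < lam :=
        mk_insert_le.trans_lt
          (add_lt_of_lt hreg.aleph0_le hU (one_lt_aleph0.trans_le hreg.aleph0_le))
      obtain ⟨b, hb, hbU⟩ : ∃ b ∈ A, b ∉ insert a (⋃ j : p a, {b | b ∈ A ∧ (j : J) ∈ p b}) :=
        not_subset.1 fun hsub ↦ (hA.trans (mk_le_mk_of_subset hsub)).not_gt hU'
      refine ⟨a, ha, b, hb, fun hab ↦ hbU (by simp [hab]), fun j hja hjb ↦ ?_⟩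
      exact (hbU (mem_insert_of_mem _ (mem_iUnion.2 ⟨⟨j, hja⟩, hb, hjb⟩))).elim

/-- Among `lam` many finite partial functions with fewer than `lam` values at each point,
two are compatible. -/
theorem exists_ne_agree {ι J : Type} {V : J → Type} {lam : Cardinal.{0}}
    (hreg : lam.IsRegular) (hunc : ℵ₀ < lam) (hV : ∀ j, #(V j) < lam) (hι : #ι = lam)
    (v : ι → ∀ j, V j) (p : ι → Finset J) :
    ∃ a b, a ≠ b ∧ ∀ j ∈ p a, j ∈ p b → v a j = v b j := by
  obtain ⟨n, hn⟩ := infinite_pigeonhole_card (fun a ↦ (p a).card) lam hι.ge hreg.aleph0_le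
    (by rwa [hreg.cof_ord, mk_nat])
  obtain ⟨a, -, b, -, h⟩ := exists_ne_agree_of_card_le hreg hV v n p _ hn (fun a ha ↦ le_of_eq ha)
  exact ⟨a, b, h⟩

section Independent

variable {S P K : Type} {V : K → Type}

/-- The cell cut out by finitely many of the sets `A a` (or their complements) and finitely many
pieces of the partitions `h k`. -/
def cell (A : P → Set S) (h : ∀ k, S → V k) (p : Finset P) (v : Set P) (q : Finset K)
    (w : ∀ k, V k) : Set S :=
  {s | (∀ a ∈ p, s ∈ A a ↔ a ∈ v) ∧ ∀ k ∈ q, h k s = w k}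

/-- The two-piece partitions given by the sets `A a` and the partitions `h k` are jointly
independent. -/
def IsIndep (A : P → Set S) (h : ∀ k, S → V k) : Prop :=
  ∀ p v q w, (cell A h p v q w).Nonempty

/-- The sets `A a`, shrunk to `t a` for the indices `a ∈ Y`. -/
def shrink (A t : P → Set S) (Y : Set P) (a : P) : Set S :=
  {s | s ∈ A a ∧ (a ∈ Y → s ∈ t a)}

theorem IsIndep.exists_maximal_shrink {A t : P → Set S} {h : ∀ k, S → V k} (hA : IsIndep A h) :
    ∃ Y, Maximal (fun Y ↦ IsIndep (shrink A t Y) h) Y := by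
  refine zorn_subset {Y | IsIndep (shrink A t Y) h} fun c hc hchain ↦ ?_
  rcases c.eq_empty_or_nonempty with rfl | hne
  · refine ⟨∅, ?_, by simp⟩
    simpa [IsIndep, shrink, cell] using hA
  refine ⟨⋃₀ c, fun p v q w ↦ ?_, fun s hs ↦ Set.subset_sUnion_of_mem hs⟩
  classical
  obtain ⟨Y, hY, hpY⟩ := DirectedOn.exists_mem_subset_of_finset_subset_biUnion (f := id)
    (s := p.filter (· ∈ ⋃₀ c)) hne hchain.directedOn (by
      intro a ha
      have := (Finset.mem_filter.1 ha).2
      simpa using this)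
  obtain ⟨s, hs, hsw⟩ := hc hY p v q w
  refine ⟨s, fun a ha ↦ ?_, hsw⟩
  have hiff : a ∈ ⋃₀ c ↔ a ∈ Y :=
    ⟨fun h ↦ hpY (Finset.mem_coe.2 (Finset.mem_filter.2 ⟨ha, h⟩)), fun h ↦ ⟨Y, hY, h⟩⟩
  rw [← hs a ha]
  simp only [shrink, Set.mem_ofPred_eq, hiff]

theorem exists_cell_subset_of_maximal_shrink {A t : P → Set S} {h : ∀ k, S → V k}
    (ht : Function.Surjective t) {Y : Set P}
    (hY : Maximal (fun Y ↦ IsIndep (shrink A t Y) h) Y) {E : Set S}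
    (hE : ∀ (p : Finset P) (v : Set P), ∃ s ∈ E, ∀ a ∈ p, s ∈ shrink A t Y a ↔ a ∈ v) :
    ∃ p v q w, cell (shrink A t Y) h p v q w ⊆ E := by
  classical
  by_contra! hcell
  obtain ⟨a, ha⟩ := ht Eᶜ
  have haY : a ∉ Y := by
    intro haY
    obtain ⟨s, hsE, hs⟩ := hE {a} {a}
    have := ((hs a (by simp)).2 rfl).2 haY
    rw [ha] at this
    exact this hsE
  refine haY (hY.2 (y := insert a Y) (fun p v q w ↦ ?_) (Set.subset_insert a Y)
    (Set.mem_insert a Y))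
  obtain ⟨s, ⟨hs, hsw⟩, hsE⟩ := Set.not_subset.1 (hcell (insert a p) v q w)
  refine ⟨s, fun b hb ↦ ?_, hsw⟩
  rw [← hs b (Finset.mem_insert_of_mem hb)]
  simp only [shrink, Set.mem_ofPred_eq, Set.mem_insert_iff]
  by_cases hba : b = a
  · subst hba
    simp [ha, hsE, haY]
  · simp [hba]

end Independent

/-- The Fichtenholz–Kantorovich–Hausdorff construction of `2 ^ #L` independent sets, together
with `#L` independent partitions, on a set of size `#L`. -/
theorem exists_isIndep (L : Type) [Infinite L] (V : L → Set L) (hV : ∀ i, (V i).Nonempty) :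
    ∃ (S : Type) (A : Set L → Set S) (h : ∀ i, S → V i), #S = #L ∧ IsIndep A h := by
  classical
  let h : ∀ i, Finset L × Finset (Finset L) × Finset (L × L) → V i := fun i s ↦
    if hx : ∃ x : V i, (i, (x : L)) ∈ s.2.2 then hx.choose else ⟨_, (hV i).some_mem⟩
  refine ⟨Finset L × Finset (Finset L) × Finset (L × L),
    fun X ↦ {s | s.1.filter (· ∈ X) ∈ s.2.1}, h, ?_, ?_⟩
  · have hL : ℵ₀ ≤ #L := aleph0_le_mk L
    simp [mul_eq_self hL]
  intro p v q w
  have hsep : ∀ X Y : Set L, ∃ x, X ≠ Y → ¬ (x ∈ X ↔ x ∈ Y) := by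
    intro X Y
    by_cases hXY : X = Y
    · exact ⟨Classical.arbitrary L, fun h ↦ (h hXY).elim⟩
    · by_contra! H
      exact hXY (Set.ext fun x ↦ (H x).2)
  choose d hd using hsep
  let T : Finset L := (p ×ˢ p).image fun z ↦ d z.1 z.2
  refine ⟨(T, (p.filter (· ∈ v)).image (fun X ↦ T.filter (· ∈ X)),
    q.image fun k ↦ (k, (w k : L))), fun X hX ↦ ?_, fun k hk ↦ ?_⟩
  · simp only [Set.mem_ofPred_eq, Finset.mem_image, Finset.mem_filter]
    constructor
    · rintro ⟨Y, ⟨hYp, hYv⟩, hYX⟩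
      have : Y = X := by
        by_contra hne
        refine hd Y X hne ?_
        have hT : d Y X ∈ T := Finset.mem_image.2 ⟨(Y, X), by simp [hYp, hX], rfl⟩
        have := Finset.ext_iff.1 hYX (d Y X)
        simpa [hT] using this
      exact this ▸ hYv
    · exact fun hXv ↦ ⟨X, ⟨hX, hXv⟩, rfl⟩
  · have hx : ∃ x : V k, (k, (x : L)) ∈ q.image fun k ↦ (k, (w k : L)) :=
      ⟨w k, Finset.mem_image_of_mem _ hk⟩
    have hspec := hx.choose_spec
    simp only [h, dif_pos hx]
    obtain ⟨k', -, hk'⟩ := Finset.mem_image.1 hspec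
    obtain ⟨rfl, h2⟩ := Prod.ext_iff.1 hk'
    exact Subtype.ext h2.symm

/-- An independent family indexed by triples `(Y, a, b)` in which the set at `(Y, a, b)`
separates `a` from `b`. -/
theorem exists_isIndep_separating (L : Type) [Infinite L] (V : L → Set L)
    (hV : ∀ i, (V i).Nonempty) :
    ∃ (S : Type) (A : Set S × S × S → Set S) (h : ∀ i, S → V i), IsIndep A h ∧
      ∀ Y a b, a ≠ b → a ∈ A (Y, a, b) ∧ b ∉ A (Y, a, b) := by
  classical
  obtain ⟨S, A, h, hS, hA⟩ := exists_isIndep L V hV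
  have hL : ℵ₀ ≤ #L := aleph0_le_mk L
  have hcard : #(Set (S × ℕ) × (S × ℕ) × (S × ℕ)) = #(Set L) := by
    simp only [mk_prod, lift_id, mk_set, hS, mk_nat, mul_eq_left hL hL aleph0_ne_zero,
      mul_eq_self hL]
    exact mul_eq_left (hL.trans (cantor _).le) (cantor _).le (aleph0_pos.trans_le hL).ne'
  obtain ⟨e⟩ := Cardinal.eq.1 hcard
  refine ⟨S × ℕ, fun z ↦ {s | (s.1 ∈ A (e z) ∨ s = z.2.1) ∧ s ≠ z.2.2}, fun i s ↦ h i s.1,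
    fun p v q w ↦ ?_, fun Y a b hab ↦ by simp [hab]⟩
  obtain ⟨s, hs, hsw⟩ := hA (p.map e.toEmbedding) (e '' v) q w
  obtain ⟨n, hn⟩ := Infinite.exists_notMem_finset
    (p.image (fun z ↦ z.2.1.2) ∪ p.image fun z ↦ z.2.2.2)
  refine ⟨(s, n), fun z hz ↦ ?_, hsw⟩
  have h1 : (s, n) ≠ z.2.1 := by
    rintro h
    exact hn (Finset.mem_union_left _ (Finset.mem_image.2 ⟨z, hz, by simp [← h]⟩))
  have h2 : (s, n) ≠ z.2.2 := by
    rintro h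
    exact hn (Finset.mem_union_right _ (Finset.mem_image.2 ⟨z, hz, by simp [← h]⟩))
  have h3 := hs (e z) (by simpa using hz)
  rw [e.injective.mem_set_image] at h3
  simp [h1, h2, h3]

section Topology

variable {S P : Type}

open Classical in
/-- The topology on `S` generated by the sets `B a` and their complements. -/
@[reducible]
noncomputable def clopenTopology (B : P → Set S) : TopologicalSpace S :=
  TopologicalSpace.induced (fun s a ↦ decide (s ∈ B a)) inferInstance

theorem zeroDimensional_clopenTopology (B : P → Set S) :
    @ZeroDimensional S (clopenTopology B) := by
  let _ := clopenTopology B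
  rintro x U hU hx
  obtain ⟨W, hW, rfl⟩ := isOpen_induced_iff.1 hU
  obtain ⟨C, hC, hxC, hCW⟩ := compact_exists_isClopen_in_isOpen hW hx
  exact ⟨_, hC.preimage continuous_induced_dom, hxC, Set.preimage_mono hCW⟩

theorem t2Space_clopenTopology (B : P → Set S)
    (hB : ∀ a b, a ≠ b → ∃ z, a ∈ B z ∧ b ∉ B z) : @T2Space S (clopenTopology B) := by
  classical
  let _ := clopenTopology B
  refine T2Space.of_injective_continuous (f := fun s a ↦ decide (s ∈ B a)) (fun a b hab ↦ ?_)
    continuous_induced_dom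
  by_contra hne
  obtain ⟨z, ha, hb⟩ := hB a b hne
  have := congrFun hab z
  simp_all

theorem isOpen_clopenTopology (B : P → Set S) (p : Finset P) (v : Set P) :
    @IsOpen S (clopenTopology B) {s | ∀ a ∈ p, s ∈ B a ↔ a ∈ v} := by
  classical
  refine isOpen_induced_iff.2 ⟨Set.pi p fun a ↦ {decide (a ∈ v)},
    isOpen_set_pi p.finite_toSet fun _ _ ↦ isOpen_discrete _, ?_⟩
  ext s
  simp [Set.mem_pi]

theorem dense_clopenTopology (B : P → Set S) (E : Set S)
    (hE : ∀ (p : Finset P) (v : Set P), ∃ s ∈ E, ∀ a ∈ p, s ∈ B a ↔ a ∈ v) :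
    @Dense S (clopenTopology B) E := by
  classical
  let _ := clopenTopology B
  rw [dense_iff_inter_open]
  rintro U hU ⟨x, hx⟩
  obtain ⟨W, hW, rfl⟩ := isOpen_induced_iff.1 hU
  obtain ⟨p, u, hu, hpu⟩ := isOpen_pi_iff.1 hW _ hx
  obtain ⟨s, hsE, hs⟩ := hE p {a | x ∈ B a}
  refine ⟨s, hpu fun a ha ↦ ?_, hsE⟩
  have : decide (s ∈ B a) = decide (x ∈ B a) := by simpa using hs a ha
  simpa only [this] using (hu a ha).2

end Topology

/-- For every uncountable regular cardinal λ there is a zero-dimensional Hausdorff space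
which is μ-resolvable for all μ < λ but not λ-resolvable. -/
theorem exists_zeroDim_T2_resolvable_below_not_at (lam : Cardinal)
    (hreg : lam.IsRegular) (hunc : Cardinal.aleph0 < lam) :
    ∃ (X : Type) (_ : TopologicalSpace X),
      ZeroDimensional X ∧ T2Space X ∧
      (∀ μ : Cardinal, μ < lam → Resolvable X μ) ∧ ¬ Resolvable X lam := by
  classical
  let L := lam.ord.ToType
  have hLcard : #L = lam := mk_ord_toType lam
  have : Infinite L := infinite_iff.2 (hLcard ▸ hunc.le)
  let V : L → Set L := Set.Iic
  have hVlt : ∀ i, #(V i) < lam := fun i ↦ by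
    have h1 : V i = insert i (Set.Iio i) := (Set.Iio_insert).symm
    rw [h1]
    exact mk_insert_le.trans_lt (add_lt_of_lt hreg.aleph0_le
      ((mk_Iio_lt i (by simp [L])).trans_eq hLcard) (one_lt_aleph0.trans hunc))
  have hVlarge : ∀ μ < lam, ∃ i, μ ≤ #(V i) := by
    intro μ hμ
    have hlt : μ.ord < Ordinal.type (α := L) (· < ·) := by
      rw [Ordinal.type_toType]
      exact ord_lt_ord.2 hμ
    refine ⟨Ordinal.enum (α := L) (· < ·) ⟨μ.ord, hlt⟩, ?_⟩
    have h1 : μ = #(Set.Iio (Ordinal.enum (α := L) (· < ·) ⟨μ.ord, hlt⟩)) :=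
      (card_ord μ).symm.trans
        (congrArg Ordinal.card (Ordinal.typein_enum (α := L) (· < ·) hlt).symm)
    exact h1.le.trans (mk_le_mk_of_subset Set.Iio_subset_Iic_self)
  obtain ⟨S, A, h, hA, hsep⟩ := exists_isIndep_separating L V fun i ↦ ⟨i, Set.self_mem_Iic⟩
  obtain ⟨Y, hY⟩ := hA.exists_maximal_shrink (t := Prod.fst)
  have hind : IsIndep (shrink A Prod.fst Y) h := hY.1
  have htsurj : Function.Surjective (Prod.fst : Set S × S × S → Set S) := fun E ↦ by
    obtain ⟨s, -⟩ := hA ∅ ∅ ∅ fun i ↦ ⟨i, Set.self_mem_Iic⟩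
    exact ⟨(E, s, s), rfl⟩
  let _ := clopenTopology (shrink A Prod.fst Y)
  refine ⟨S, inferInstance, zeroDimensional_clopenTopology _,
    t2Space_clopenTopology _ fun a b hab ↦ ⟨(Set.univ, a, b), ?_⟩, fun μ hμ ↦ ?_, ?_⟩
  · obtain ⟨h1, h2⟩ := hsep Set.univ a b hab
    exact ⟨⟨h1, fun _ ↦ trivial⟩, fun h ↦ h2 h.1⟩
  · obtain ⟨i, hi⟩ := hVlarge μ hμ
    rw [← mk_out μ, le_def] at hi
    obtain ⟨f⟩ := hi
    have hpiece : ∀ x : V i, ∀ (p : Finset (Set S × S × S)) (v : Set (Set S × S × S)),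
        ∃ s ∈ {s | h i s = x}, ∀ a ∈ p, s ∈ shrink A Prod.fst Y a ↔ a ∈ v := by
      intro x p v
      obtain ⟨s, hs, hsw⟩ := hind p v {i} (Function.update (fun k ↦ ⟨k, Set.self_mem_Iic⟩) i x)
      exact ⟨s, by simpa using hsw i (by simp), hs⟩
    refine ⟨Set.range fun m ↦ {s | h i s = f m}, ?_, ?_, ?_⟩
    · rw [mk_range_eq, mk_out]
      intro m n hmn
      obtain ⟨s, hs, -⟩ := hpiece (f m) ∅ ∅
      have hs' : s ∈ {s | h i s = f n} := (Set.ext_iff.1 hmn s).1 hs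
      exact f.injective (hs.symm.trans hs')
    · rintro _ ⟨m, rfl⟩
      exact dense_clopenTopology _ _ (hpiece _)
    · rintro _ ⟨m, rfl⟩ _ ⟨n, rfl⟩ hmn
      refine Set.disjoint_left.2 fun s hs hs' ↦ hmn ?_
      have : f m = f n := Eq.trans (Eq.symm hs) hs'
      simp only [this]
  · rintro ⟨D, hD, hdense, hdisj⟩
    have hcell : ∀ d : D, ∃ p v q w, cell (shrink A Prod.fst Y) h p v q w ⊆ d := fun d ↦
      exists_cell_subset_of_maximal_shrink htsurj hY (fun p v ↦ by
        obtain ⟨s, hs, -⟩ := hind p v ∅ fun i ↦ ⟨i, Set.self_mem_Iic⟩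
        obtain ⟨s', hs', hsd⟩ := (hdense d d.2).inter_open_nonempty _
          (isOpen_clopenTopology (shrink A Prod.fst Y) p v) ⟨s, hs⟩
        exact ⟨s', hsd, hs'⟩)
    choose p v q w hsub using hcell
    let V' : (Set S × S × S) ⊕ L → Type := fun j ↦ Sum.casesOn j (fun _ ↦ Prop) fun i ↦ V i
    obtain ⟨d, d', hne, hagree⟩ := exists_ne_agree (V := V') hreg hunc
      (by
        rintro (j | i)
        · exact (lt_aleph0_of_finite Prop).trans hunc
        · exact hVlt i) hD
      (fun d j ↦ Sum.casesOn (motive := V') j (fun a ↦ a ∈ v d) fun i ↦ w d i)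
      (fun d ↦ (p d).disjSum (q d))
    obtain ⟨s, hs, hsw⟩ := hind (p d ∪ p d') {a | if a ∈ p d then a ∈ v d else a ∈ v d'}
      (q d ∪ q d') fun k ↦ if k ∈ q d then w d k else w d' k
    have hsd : s ∈ (d : Set S) := hsub d ⟨fun a ha ↦ by
      simpa [ha] using hs a (Finset.mem_union_left _ ha), fun k hk ↦ by
      simpa [hk] using hsw k (Finset.mem_union_left _ hk)⟩
    have hsd' : s ∈ (d' : Set S) := hsub d' ⟨fun a ha ↦ by
      rw [hs a (Finset.mem_union_right _ ha), Set.mem_ofPred_eq]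
      split_ifs with had
      · exact iff_of_eq (hagree (Sum.inl a) (by simpa using had) (by simpa using ha))
      · rfl, fun k hk ↦ by
      rw [hsw k (Finset.mem_union_right _ hk)]
      beta_reduce
      split_ifs with hkd
      · exact hagree (Sum.inr k) (by simpa using hkd) (by simpa using hk)
      · rfl⟩
    exact Set.disjoint_left.1 (hdisj d.2 d'.2 fun h ↦ hne (Subtype.ext h)) hsd hsd'
end

section
/- There exists an ω-resolvable Tychonoff topological space which is not maximally resolvable. -/
open Cardinal

open Set MeasureTheory

/-- The subspace of the Cantor cube `I → Bool` parametrised by `f` meets every nonempty open box in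
uncountably many points of each label. -/
def LabelIndependent {X I : Type*} (lab : X → ℕ) (f : X → I → Bool) : Prop :=
  ∀ (F : Finset I) (p : I → Bool) (n : ℕ) (C : Set X), C.Countable →
    ∃ x, x ∉ C ∧ lab x = n ∧ ∀ i ∈ F, f x i = p i

/-- A Hausdorff-style independent family: the set of pairs consisting of a finite set and a finite
family of finite sets parametrises a dense subset of a Cantor cube. -/
theorem exists_independent_family {T I : Type*} (s : I → Set T) (hs : Function.Injective s) :
    ∃ c : Finset T × Finset (Finset T) → I → Bool,
      ∀ (F : Finset I) (p : I → Bool), ∃ y, ∀ i ∈ F, c y i = p i := by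
  classical
  refine ⟨fun y i ↦ decide (y.1.filter (· ∈ s i) ∈ y.2), fun F p ↦ ?_⟩
  have hsep : ∀ q : I × I, ∃ t : Set T, t.Subsingleton ∧
      (q.1 ≠ q.2 → ∃ a ∈ t, ¬ (a ∈ s q.1 ↔ a ∈ s q.2)) := by
    rintro ⟨i, j⟩
    by_cases hij : i = j
    · exact ⟨∅, subsingleton_empty, fun h ↦ absurd hij h⟩
    · have : ∃ a, ¬ (a ∈ s i ↔ a ∈ s j) := by
        by_contra! h
        exact hij (hs (Set.ext h))
      obtain ⟨a, ha⟩ := this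
      exact ⟨{a}, subsingleton_singleton, fun _ ↦ ⟨a, rfl, ha⟩⟩
  choose t ht hts using hsep
  let G : Finset T := (F ×ˢ F).biUnion fun q ↦ (ht q).finite.toFinset
  refine ⟨(G, (F.filter (p · = true)).image fun i ↦ G.filter (· ∈ s i)), fun i hi ↦ ?_⟩
  have hmem : G.filter (· ∈ s i) ∈ (F.filter (p · = true)).image (fun i ↦ G.filter (· ∈ s i)) ↔
      p i = true := by
    simp only [Finset.mem_image, Finset.mem_filter]
    refine ⟨?_, fun h ↦ ⟨i, ⟨hi, h⟩, rfl⟩⟩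
    rintro ⟨j, ⟨hj, hpj⟩, hji⟩
    by_cases hij : j = i
    · exact hij ▸ hpj
    · obtain ⟨a, ha, hne⟩ := hts (j, i) hij
      have haG : a ∈ G := Finset.mem_biUnion.2 ⟨(j, i), by simp [hi, hj], by simpa using ha⟩
      have := congrArg (a ∈ ·) hji
      simp only [Finset.mem_filter, haG, true_and, eq_iff_iff] at this
      exact absurd this hne
  rw [Bool.eq_iff_iff, decide_eq_true_iff]
  exact hmem

/-- The coordinates indexed by the members `E` of `A` are set to `false` on `E`. -/
noncomputable def vanishOn {X J : Type*} (c : X → J ⊕ Set X → Bool) (A : Set (Set X)) (x : X) :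
    J ⊕ Set X → Bool :=
  open Classical in
  Sum.elim (fun j ↦ c x (.inl j)) fun E ↦ if E ∈ A ∧ x ∈ E then false else c x (.inr E)

section vanishOn

variable {X J : Type*} (c : X → J ⊕ Set X → Bool)

theorem vanishOn_congr {A A' : Set (Set X)} {i : J ⊕ Set X} (x : X)
    (h : ∀ E, i = .inr E → x ∈ E → (E ∈ A ↔ E ∈ A')) : vanishOn c A x i = vanishOn c A' x i := by
  rcases i with j | E
  · rfl
  · classical
    exact if_congr (and_congr_left (h E rfl)) rfl rfl

theorem vanishOn_inr_of_mem {A : Set (Set X)} {E : Set X} (hE : E ∈ A) {x : X} (hx : x ∈ E) :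
    vanishOn c A x (.inr E) = false := by
  simp [vanishOn, hE, hx]

theorem exists_maximal_labelIndependent {lab : X → ℕ} (hc : LabelIndependent lab c) :
    ∃ A, Maximal (fun A ↦ LabelIndependent lab (vanishOn c A)) A := by
  refine zorn_subset {A | LabelIndependent lab (vanishOn c A)} fun S hS hchain ↦ ?_
  rcases S.eq_empty_or_nonempty with rfl | hne
  · refine ⟨∅, ?_, by simp⟩
    have : vanishOn c ∅ = c := by
      ext x (j | E) <;> simp [vanishOn]
    simpa [this] using hc
  refine ⟨⋃₀ S, fun F p n C hC ↦ ?_, fun _ ↦ subset_sUnion_of_mem⟩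
  have hfin : (⋃₀ S ∩ Sum.inr ⁻¹' (F : Set (J ⊕ Set X))).Finite :=
    (F.finite_toSet.preimage Sum.inr_injective.injOn).inter_of_right _
  obtain ⟨A, hA, hsub⟩ := hchain.directedOn.exists_mem_subset_of_finite_of_subset_sUnion hne hfin
    inter_subset_left
  obtain ⟨x, hxC, hxn, hx⟩ := hS hA F p n C hC
  refine ⟨x, hxC, hxn, fun i hi ↦ (vanishOn_congr c x ?_).trans (hx i hi)⟩
  rintro E rfl -
  exact ⟨fun h ↦ hsub ⟨h, hi⟩, fun h ↦ ⟨A, hA, h⟩⟩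

end vanishOn

theorem isOpen_box {I : Type*} (F : Finset I) (p : I → Bool) :
    IsOpen {g : I → Bool | ∀ i ∈ F, g i = p i} :=
  isOpen_set_pi F.finite_toSet fun i _ ↦ isOpen_discrete {p i}

theorem exists_box_subset {I : Type*} {U : Set (I → Bool)} (hU : IsOpen U) {p : I → Bool}
    (hp : p ∈ U) : ∃ F : Finset I, {g : I → Bool | ∀ i ∈ F, g i = p i} ⊆ U := by
  obtain ⟨F, u, hu, hsub⟩ := isOpen_pi_iff.1 hU p hp
  refine ⟨F, fun g hg ↦ hsub fun i hi ↦ ?_⟩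
  rw [hg i hi]
  exact (hu i hi).2

/-- Cantor cubes have the countable chain condition. -/
theorem countable_of_pairwise_disjoint_box {ι I : Type*} (F : ι → Finset I) (p : ι → I → Bool)
    (h : Pairwise fun a b ↦ Disjoint {g : I → Bool | ∀ i ∈ F a, g i = p a i}
      {g : I → Bool | ∀ i ∈ F b, g i = p b i}) : Countable ι := by
  let μ : Measure (I → Bool) := Measure.infinitePi fun _ ↦ (PMF.uniformOfFintype Bool).toMeasure
  have hpi : ∀ a, {g : I → Bool | ∀ i ∈ F a, g i = p a i} =
      (F a : Set I).pi fun i ↦ {p a i} := fun a ↦ rfl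
  have hcount := Measure.countable_meas_pos_of_disjoint_iUnion (μ := μ)
    (As := fun a ↦ {g : I → Bool | ∀ i ∈ F a, g i = p a i})
    (fun a ↦ .pi (F a).countable_toSet fun i _ ↦ measurableSet_singleton (p a i)) h
  have huniv : {a | 0 < μ {g : I → Bool | ∀ i ∈ F a, g i = p a i}} = Set.univ := by
    refine eq_univ_of_forall fun a ↦ ?_
    rw [mem_ofPred_eq, hpi, Measure.infinitePi_pi _ fun i _ ↦ measurableSet_singleton (p a i),
      pos_iff_ne_zero, Finset.prod_ne_zero_iff]
    intro i _
    rw [PMF.toMeasure_apply_singleton _ _ (measurableSet_singleton _)]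
    simp
  rw [huniv] at hcount
  exact countable_univ_iff.1 hcount

/-- Sets that contain, up to countably many points, the part of some label class inside some box
cannot form an uncountable disjoint family. -/
theorem LabelIndependent.countable_of_pairwiseDisjoint {X I : Type*} {lab : X → ℕ}
    {f : X → I → Bool} (hf : LabelIndependent lab f) {D : Set (Set X)}
    (hD : D.PairwiseDisjoint id)
    (h : ∀ d ∈ D, ∃ (F : Finset I) (p : I → Bool) (n : ℕ) (C : Set X), C.Countable ∧
      ∀ x ∉ C, lab x = n → (∀ i ∈ F, f x i = p i) → x ∈ d) : D.Countable := by
  classical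
  replace h : ∀ d : D, ∃ (F : Finset I) (p : I → Bool) (n : ℕ) (C : Set X), C.Countable ∧
      ∀ x ∉ C, lab x = n → (∀ i ∈ F, f x i = p i) → x ∈ d.1 := fun d ↦ h d.1 d.2
  choose F p n C hC hd using h
  have hfib : ∀ k, (n ⁻¹' {k}).Countable := by
    intro k
    refine countable_coe_iff.1 (countable_of_pairwise_disjoint_box (fun a : n ⁻¹' {k} ↦ F a)
      (fun a ↦ p a) fun a b hab ↦ ?_)
    refine Set.disjoint_left.2 fun g hga hgb ↦ ?_
    obtain ⟨x, hxC, hxn, hx⟩ := hf (F a ∪ F b) g k (C a ∪ C b) ((hC a).union (hC b))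
    simp only [mem_union, not_or] at hxC
    have hxa := hd a x hxC.1 (hxn.trans a.2.symm) fun i hi ↦
      (hx i (Finset.mem_union_left _ hi)).trans (hga i hi)
    have hxb := hd b x hxC.2 (hxn.trans b.2.symm) fun i hi ↦
      (hx i (Finset.mem_union_right _ hi)).trans (hgb i hi)
    exact Set.disjoint_left.1 (hD a.1.2 b.1.2 fun h ↦ hab (Subtype.ext (Subtype.ext h))) hxa hxb
  rw [← countable_coe_iff, ← countable_univ_iff]
  exact (countable_iUnion hfib).mono fun d _ ↦ mem_iUnion.2 ⟨n d, rfl⟩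

/-- An independent family on a set of cardinality `𝔠`, indexed by pairs of points and by subsets,
whose coordinates indexed by pairs separate points. -/
theorem exists_separating_labelIndependent :
    ∃ (X : Type) (lab : X → ℕ) (c : X → (X × X) ⊕ Set X → Bool), LabelIndependent lab c ∧
      ∀ x y, x ≠ y → c x (.inl (x, y)) ≠ c y (.inl (x, y)) := by
  classical
  let X := (Finset ℝ × Finset (Finset ℝ)) × ℝ × ℕ
  have hX : #X = #ℝ := by
    have h1 : #(Finset ℝ) = #ℝ := mk_finset_of_infinite ℝ
    have h2 : #(Finset (Finset ℝ)) = #ℝ := (mk_finset_of_infinite _).trans h1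
    simp [X, h1, h2]
  obtain ⟨s, hs⟩ : ∃ s : (X × X) ⊕ Set X → Set ℝ, Function.Injective s := by
    suffices #((X × X) ⊕ Set X) ≤ #(Set ℝ) from ⟨_, (Classical.choice this).injective⟩
    have := (cantor (#ℝ)).le
    simpa [hX, mk_set] using add_le_of_le (aleph0_le_mk ℝ |>.trans this) this le_rfl
  obtain ⟨c, hc⟩ := exists_independent_family s hs
  let c' : X → (X × X) ⊕ Set X → Bool := fun x i ↦ i.elim
    (fun q ↦ if x = q.1 then true else if x = q.2 then false else c x.1 i) fun _ ↦ c x.1 i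
  refine ⟨X, fun x ↦ x.2.2, c', fun F p n C hC ↦ ?_, fun x y hxy ↦ ?_⟩
  · obtain ⟨y, hy⟩ := hc F p
    let Q : Set X := ⋃ i ∈ F, i.elim (fun q ↦ {q.1, q.2}) fun _ ↦ ∅
    have hQ : Q.Countable := by
      refine F.countable_toSet.biUnion fun i _ ↦ ?_
      rcases i with q | E
      · exact (toFinite {q.1, q.2}).countable
      · exact countable_empty
    have hinj : Function.Injective fun t : ℝ ↦ ((y, t, n) : X) := fun a b h ↦ by
      simpa using h
    obtain ⟨t, ht⟩ : ∃ t : ℝ, ((y, t, n) : X) ∉ C ∪ Q := by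
      by_contra! h
      exact not_countable_univ (((hC.union hQ).preimage hinj).mono fun t _ ↦ h t)
    rw [mem_union, not_or] at ht
    refine ⟨(y, t, n), ht.1, rfl, fun i hi ↦ ?_⟩
    have hiQ : ((y, t, n) : X) ∉ i.elim (fun q : X × X ↦ ({q.1, q.2} : Set X)) fun _ ↦ ∅ :=
      fun h ↦ ht.2 (mem_biUnion hi h)
    rw [← hy i hi]
    rcases i with q | E
    · simp only [Sum.elim_inl, mem_insert_iff, mem_singleton_iff, not_or] at hiQ
      simp [c', hiQ.1, hiQ.2]
    · rfl
  · simp [c', hxy.symm]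

/-- There is an ω-resolvable Tychonoff space which is not maximally resolvable. -/
theorem exists_omega_resolvable_not_maximally_resolvable :
    ∃ (X : Type) (_ : TopologicalSpace X),
      T35Space X ∧ Resolvable X Cardinal.aleph0 ∧ ¬ MaximallyResolvable X := by
  obtain ⟨X, lab, c, hc, hsep⟩ := exists_separating_labelIndependent
  obtain ⟨A, hA⟩ := exists_maximal_labelIndependent c hc
  set f := vanishOn c A with hf
  have hind : LabelIndependent lab f := hA.prop
  have hinj : Function.Injective f := fun x y hxy ↦ by
    by_contra hne
    exact hsep x y hne (congrFun hxy (.inl (x, y)))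
  let _ : TopologicalSpace X := .induced f inferInstance
  have hopen : ∀ U : Set X, IsOpen U → U.Nonempty →
      ∃ (F : Finset _) (p : _ → Bool), {x | ∀ i ∈ F, f x i = p i} ⊆ U := by
    rintro _ ⟨V, hV, rfl⟩ ⟨x, hx⟩
    obtain ⟨F, hF⟩ := exists_box_subset hV hx
    exact ⟨F, f x, fun y hy ↦ hF hy⟩
  have hemb : Topology.IsEmbedding f := ⟨⟨rfl⟩, hinj⟩
  have hdense : ∀ n, Dense (lab ⁻¹' {n}) := fun n ↦ dense_iff_inter_open.2 fun U hU hne ↦ by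
    obtain ⟨F, p, hsub⟩ := hopen U hU hne
    obtain ⟨x, -, hxn, hx⟩ := hind F p n ∅ countable_empty
    exact ⟨x, hsub hx, hxn⟩
  obtain ⟨x₀, -⟩ := hind ∅ (fun _ ↦ true) 0 ∅ countable_empty
  have : Nonempty X := ⟨x₀⟩
  refine ⟨X, inferInstance, hemb.t35Space, ?_, ?_⟩
  · have hdisj : Pairwise fun m n ↦ Disjoint (lab ⁻¹' {m}) (lab ⁻¹' {n}) := fun m n hmn ↦
      (disjoint_singleton.2 hmn).preimage lab
    refine ⟨range fun n ↦ lab ⁻¹' {n}, ?_, forall_mem_range.2 hdense, ?_⟩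
    · rw [mk_range_eq, mk_nat]
      intro m n hmn
      by_contra hne
      have : Disjoint (lab ⁻¹' {m}) (lab ⁻¹' {n}) := hdisj hne
      simp only at hmn
      rw [hmn, disjoint_self] at this
      exact (hdense n).nonempty.ne_empty this
    · rintro _ ⟨m, rfl⟩ _ ⟨n, rfl⟩ hmn
      exact hdisj fun h ↦ hmn (h ▸ rfl)
  · rintro ⟨D, hDcard, hDdense, hDdisj⟩
    have hcount : D.Countable := by
      refine hind.countable_of_pairwiseDisjoint hDdisj fun E hE ↦ ?_
      by_cases hEA : E ∈ A
      · exfalso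
        obtain ⟨y, -, -, hy⟩ := hind {.inr E} (fun _ ↦ true) 0 ∅ countable_empty
        have hbox := (isOpen_box {.inr E} fun _ ↦ true).preimage hemb.continuous
        obtain ⟨x, hx, hxE⟩ := (hDdense E hE).inter_open_nonempty _ hbox ⟨y, hy⟩
        have h1 := hx (.inr E) (Finset.mem_singleton_self _)
        rw [hf, vanishOn_inr_of_mem c hEA hxE] at h1
        exact Bool.false_ne_true h1
      · have hnot : ¬ LabelIndependent lab (vanishOn c (insert E A)) := fun h ↦
          hEA (hA.2 h (subset_insert E A) (mem_insert E A))
        simp only [LabelIndependent] at hnot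
        push Not at hnot
        obtain ⟨F, p, n, C, hC, h⟩ := hnot
        refine ⟨F, p, n, C, hC, fun x hxC hxn hx ↦ ?_⟩
        by_contra hxE
        obtain ⟨i, hi, hne⟩ := h x hxC hxn
        refine hne ((vanishOn_congr c x ?_).trans (hx i hi))
        rintro E' - hxE'
        rw [mem_insert_iff, or_iff_right]
        rintro rfl
        exact hxE hxE'
    have hDelta : Delta X ∈ {c : Cardinal | ∃ U : Set X, IsOpen U ∧ U.Nonempty ∧ #U = c} :=
      csInf_mem ⟨_, Set.univ, isOpen_univ, univ_nonempty, rfl⟩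
    obtain ⟨U, hU, hUne, hUcard⟩ := hDelta
    obtain ⟨F, p, hsub⟩ := hopen U hU hUne
    have hUcount : U.Countable := by
      rw [← le_aleph0_iff_set_countable, hUcard, ← hDcard, le_aleph0_iff_set_countable]
      exact hcount
    obtain ⟨x, hxU, -, hx⟩ := hind F p 0 U hUcount
    exact hxU (hsub hx)
end

section
/- If a topological space X satisfies Δ(X) ≥ ps(X), then X is maximally resolvable. -/
open Cardinal

/-- ps(X): the smallest successor cardinal κ⁺ such that X has no discrete subset of
size κ⁺. -/
noncomputable def psInv (X : Type*) [TopologicalSpace X] : Cardinal :=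
  sInf {c : Cardinal | (∃ κ : Cardinal, c = Order.succ κ) ∧
    ¬ ∃ D : Set X, DiscreteTopology D ∧ #D = c}

open Set

universe u

section Recursion

/-- Recursive choice along a transitive well-founded relation. -/
theorem WellFounded.exists_recursive_choice {P α : Type*} [Nonempty α] {r : P → P → Prop}
    [IsTrans P r] (hr : WellFounded r) (Q : P → (P → α) → α → Prop)
    (hcongr : ∀ p F G a, (∀ q, r q p → F q = G q) → Q p F a → Q p G a)
    (hex : ∀ p F, (∀ q, r q p → Q q F (F q)) → ∃ a, Q p F a) :
    ∃ A : P → α, ∀ p, Q p A (A p) := by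
  classical
  obtain ⟨d⟩ := ‹Nonempty α›
  let ext (p : P) (ih : ∀ q, r q p → α) : P → α := fun q => if h : r q p then ih q h else d
  let step (p : P) (ih : ∀ q, r q p → α) : α :=
    if h : ∃ a, Q p (ext p ih) a then h.choose else d
  let A : P → α := hr.fix step
  have hA (p : P) : A p = step p fun q _ => A q := hr.fix_eq step p
  have hext (p q : P) (h : r q p) : ext p (fun q _ => A q) q = A q := by simp [ext, h]
  refine ⟨A, fun p => hr.induction (C := fun p => Q p A (A p)) p fun p ih => ?_⟩
  have h : ∃ a, Q p (ext p fun q _ => A q) a := by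
    refine hex p _ fun q hq => ?_
    rw [hext p q hq]
    exact hcongr q A _ _ (fun s hs => (hext p s (_root_.trans hs hq)).symm) (ih q hq)
  have hstep : A p = h.choose := by rw [hA]; exact dif_pos h
  rw [hstep]
  exact hcongr p _ _ _ (hext p) h.choose_spec

/-- Pairwise disjoint sets can be selected one after the other, in the order of an ordinal-valued
key, as long as each requirement can be met away from the sets selected before. -/
theorem exists_pairwise_disjoint_selection {P : Type u} {β : Type*} (key : P → Ordinal.{u})
    (R : P → Set β → Prop)
    (hex : ∀ p (S : Set P) (F : P → Set β), (∀ q ∈ S, key q ≤ key p) → (∀ q ∈ S, R q (F q)) →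
      ∃ A, R p A ∧ Disjoint A (⋃ q ∈ S, F q)) :
    ∃ A : P → Set β, (∀ p, R p (A p)) ∧ Pairwise fun p q => Disjoint (A p) (A q) := by
  obtain ⟨e⟩ := Cardinal.eq.1 (mk_ord_toType #P)
  let ℓ : P → Ordinal.{u} ×ₗ (#P).ord.ToType := fun p => toLex (key p, e.symm p)
  have hℓ : Function.Injective ℓ := fun p q h =>
    e.symm.injective (congrArg (fun x => (ofLex x).2) h)
  let o : LinearOrder P := LinearOrder.lift' ℓ hℓ
  have hkey {p q : P} (h : q < p) : key q ≤ key p := by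
    rcases Prod.Lex.lt_iff.1 (show ℓ q < ℓ p from h) with h | h
    · exact h.le
    · exact h.1.le
  have hwf : WellFounded (· < · : P → P → Prop) := InvImage.wf ℓ wellFounded_lt
  obtain ⟨A, hA⟩ := hwf.exists_recursive_choice
    (fun p F a => R p a ∧ Disjoint a (⋃ q ∈ Iio p, F q))
    (fun p F G a h => by
      rw [show ⋃ q ∈ Iio p, F q = ⋃ q ∈ Iio p, G q from iUnion₂_congr fun q hq => h q hq]
      exact id)
    (fun p F h => hex p _ F (fun q hq => hkey hq) fun q hq => (h q hq).1)
  have hdisj {p q : P} (h : q < p) : Disjoint (A p) (A q) :=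
    (hA p).2.mono_right (subset_biUnion_of_mem (u := fun q => A q) h)
  refine ⟨A, fun p => (hA p).1, fun p q hpq => ?_⟩
  rcases hpq.lt_or_gt with h | h
  · exact (hdisj h).symm
  · exact hdisj h

end Recursion

section CardinalArithmetic

variable {ι α : Type u}

theorem Cardinal.IsRegular.mk_iUnion_lt {ρ τ : Cardinal.{u}} (hρ : ρ.IsRegular) (hτ : ρ ≤ τ)
    (hι : #ι < τ) {A : ι → Set α} (hA : ∀ i, #(A i) < ρ) : #(⋃ i, A i) < τ := by
  rcases lt_or_ge #ι ρ with h | h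
  · exact ((card_iUnion_lt_iff_forall_of_isRegular hρ h).2 hA).trans_le hτ
  · calc #(⋃ i, A i) ≤ sum fun i => #(A i) := mk_iUnion_le_sum_mk
      _ ≤ sum fun _ : ι => ρ := sum_le_sum _ _ fun i => (hA i).le
      _ = #ι * ρ := by simp
      _ ≤ #ι * #ι := by gcongr
      _ = #ι := mul_eq_self (hρ.aleph0_le.trans h)
      _ < τ := hι

theorem Cardinal.IsRegular.mk_biUnion_lt {ρ τ : Cardinal.{u}} (hρ : ρ.IsRegular) (hτ : ρ ≤ τ)
    {s : Set ι} (hs : #s < τ) {A : ι → Set α} (hA : ∀ i ∈ s, #(A i) < ρ) :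
    #(⋃ i ∈ s, A i) < τ := by
  rw [biUnion_eq_iUnion]
  exact hρ.mk_iUnion_lt hτ hs fun i => hA i i.2

theorem exists_injective_ordinal_card_lt (α : Type u) :
    ∃ g : α → Ordinal.{u}, Function.Injective g ∧ ∀ a, (g a).card < #α := by
  obtain ⟨r, hr, h⟩ := exists_ord_eq α
  refine ⟨Ordinal.typein r, Ordinal.typein_injective r, fun a => ?_⟩
  rw [← lt_ord, h]
  exact Ordinal.typein_lt_type r a

theorem mk_setOf_le_le_of_injective {g : α → Ordinal.{u}} (hg : Function.Injective g)
    (o : Ordinal.{u}) : #{a | g a ≤ o} ≤ o.card + 1 := by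
  have h : lift.{u + 1} #{a | g a ≤ o} ≤ lift.{u} #(Iio (o + 1)) :=
    lift_mk_le_lift_mk_of_injective (f := fun a => ⟨g a, mem_Iio.2 (Order.lt_add_one_iff.2 a.2)⟩)
      fun a b hab => Subtype.ext (hg (congrArg Subtype.val hab))
  rw [Cardinal.mk_Iio_ordinal, lift_id'.{u, u + 1}, lift_le, Ordinal.card_add_one] at h
  exact h

end CardinalArithmetic

section DisjointDense

variable {X : Type u} [TopologicalSpace X]

/-- `Y` contains `κ` pairwise disjoint subsets each of which is dense in `Y`. -/
def HasDisjointDense (κ : Cardinal.{u}) (Y : Set X) : Prop :=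
  ∃ (ι : Type u) (E : ι → Set X), #ι = κ ∧ Pairwise (fun i j => Disjoint (E i) (E j)) ∧
    ∀ i, E i ⊆ Y ∧ Y ⊆ closure (E i)

/-- `X` has no discrete subset of size `κ`. -/
def NoDiscrete (X : Type u) [TopologicalSpace X] (κ : Cardinal.{u}) : Prop :=
  ¬ ∃ D : Set X, DiscreteTopology D ∧ #D = κ

theorem HasDisjointDense.mono {κ κ' : Cardinal.{u}} {Y : Set X} (h : κ' ≤ κ)
    (hY : HasDisjointDense κ Y) : HasDisjointDense κ' Y := by
  obtain ⟨ι, E, rfl, hd, hE⟩ := hY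
  obtain ⟨s, rfl⟩ := le_mk_iff_exists_set.1 h
  exact ⟨s, fun i => E i, rfl, fun i j hij => hd (Subtype.coe_injective.ne hij), fun i => hE i⟩

theorem HasDisjointDense.image_val {κ : Cardinal.{u}} {U : Set X} {Y : Set U}
    (hY : HasDisjointDense κ Y) : HasDisjointDense κ ((↑) '' Y : Set X) := by
  obtain ⟨ι, E, rfl, hd, hE⟩ := hY
  refine ⟨ι, fun i => (↑) '' E i, rfl, fun i j hij => ?_, fun i => ⟨image_mono (hE i).1, ?_⟩⟩
  · exact (disjoint_image_iff Subtype.coe_injective).2 (hd hij)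
  · rintro _ ⟨y, hy, rfl⟩
    exact closure_subtype.1 ((hE i).2 hy)

theorem NoDiscrete.mono {κ κ' : Cardinal.{u}} (h : κ ≤ κ') (hX : NoDiscrete X κ) :
    NoDiscrete X κ' := by
  rintro ⟨D, hD, rfl⟩
  obtain ⟨p, hp, rfl⟩ := le_mk_iff_exists_subset.1 h
  exact hX ⟨p, DiscreteTopology.of_subset hD hp, rfl⟩

theorem NoDiscrete.subtype {κ : Cardinal.{u}} (hX : NoDiscrete X κ) (U : Set X) :
    NoDiscrete U κ := by
  rintro ⟨D, hD, rfl⟩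
  refine hX ⟨(↑) '' D, ?_, mk_image_eq Subtype.coe_injective⟩
  rw [discreteTopology_subtype_iff'] at hD ⊢
  rintro _ ⟨y, hy, rfl⟩
  obtain ⟨V, hV, hVD⟩ := hD y hy
  obtain ⟨W, hW, rfl⟩ := isOpen_induced_iff.1 hV
  refine ⟨W, hW, ?_⟩
  rw [inter_comm, ← image_inter_preimage, inter_comm, hVD, image_singleton]

theorem NoDiscrete.false_of_separated {ι : Type u} [LinearOrder ι] (hX : NoDiscrete X #ι)
    (z : ι → X) (h₁ : ∀ i, z i ∉ closure (z '' Iio i)) (h₂ : ∀ i, z i ∉ closure (z '' Ioi i)) :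
    False := by
  have hinj : Function.Injective z := by
    intro i j hij
    rcases lt_trichotomy i j with h | h | h
    · exact absurd (subset_closure (show z _ ∈ z '' _ from ⟨i, h, hij⟩)) (h₁ j)
    · exact h
    · exact absurd (subset_closure (show z _ ∈ z '' _ from ⟨j, h, hij.symm⟩)) (h₁ i)
  refine hX ⟨range z, discreteTopology_subtype_iff'.2 ?_, mk_range_eq z hinj⟩
  rintro _ ⟨i, rfl⟩
  refine ⟨(closure (z '' Iio i))ᶜ ∩ (closure (z '' Ioi i))ᶜ,
    isClosed_closure.isOpen_compl.inter isClosed_closure.isOpen_compl, ?_⟩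
  refine Subset.antisymm ?_ (singleton_subset_iff.2 ⟨⟨h₁ i, h₂ i⟩, mem_range_self i⟩)
  rintro _ ⟨⟨ha, hb⟩, j, rfl⟩
  rcases lt_trichotomy i j with h | h | h
  · exact absurd (subset_closure (show z _ ∈ z '' _ from ⟨j, h, rfl⟩)) hb
  · rw [h]; rfl
  · exact absurd (subset_closure (show z _ ∈ z '' _ from ⟨j, h, rfl⟩)) ha

/-- If every nonempty open set includes a member of `𝒞`, then some disjoint subfamily of `𝒞` has
dense union. -/
theorem exists_disjoint_family_dense (𝒞 : Set (Set X)) (hne : ∀ Y ∈ 𝒞, Y.Nonempty)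
    (h𝒞 : ∀ U : Set X, IsOpen U → U.Nonempty → ∃ Y ∈ 𝒞, Y ⊆ U) :
    ∃ 𝒟 ⊆ 𝒞, 𝒟.PairwiseDisjoint id ∧ Dense (⋃₀ 𝒟) := by
  obtain ⟨𝒟, h𝒟⟩ := zorn_subset {𝒟 | 𝒟 ⊆ 𝒞 ∧ 𝒟.PairwiseDisjoint id} fun c hc hchain =>
    ⟨⋃₀ c, ⟨sUnion_subset fun s hs => (hc hs).1,
      (pairwiseDisjoint_sUnion hchain.directedOn).2 fun s hs => (hc hs).2⟩,
      fun s hs => subset_sUnion_of_mem hs⟩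
  refine ⟨𝒟, h𝒟.1.1, h𝒟.1.2, ?_⟩
  by_contra hd
  obtain ⟨Y, hY, hYU⟩ := h𝒞 (closure (⋃₀ 𝒟))ᶜ isClosed_closure.isOpen_compl
    (nonempty_compl.2 fun h => hd (dense_iff_closure_eq.2 h))
  have hdisj (Z : Set X) (hZ : Z ∈ 𝒟) : Disjoint Y Z :=
    disjoint_left.2 fun x hx hxZ => hYU hx (subset_closure ⟨Z, hZ, hxZ⟩)
  have hmem : Y ∈ 𝒟 := h𝒟.2 (y := insert Y 𝒟)
    ⟨insert_subset hY h𝒟.1.1, h𝒟.1.2.insert fun Z hZ _ => hdisj Z hZ⟩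
    (subset_insert _ _) (mem_insert _ _)
  obtain ⟨x, hx⟩ := hne Y hY
  exact disjoint_left.1 (hdisj Y hmem) hx hx

theorem hasDisjointDense_univ {κ : Cardinal.{u}}
    (h : ∀ U : Set X, IsOpen U → U.Nonempty → ∃ Y ⊆ U, Y.Nonempty ∧ HasDisjointDense κ Y) :
    HasDisjointDense κ (univ : Set X) := by
  obtain ⟨𝒟, h𝒟, hdisj, hdense⟩ := exists_disjoint_family_dense
    {Y : Set X | Y.Nonempty ∧ HasDisjointDense κ Y} (fun Y hY => hY.1) fun U hU hne => by
      obtain ⟨Y, hYU, hY⟩ := h U hU hne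
      exact ⟨Y, hY, hYU⟩
  have hE (Y : 𝒟) : ∃ E : κ.ord.ToType → Set X, Pairwise (fun i j => Disjoint (E i) (E j)) ∧
      ∀ i, E i ⊆ Y.1 ∧ Y.1 ⊆ closure (E i) := by
    obtain ⟨ι, E, hι, hd, hE⟩ := (h𝒟 Y.2).2
    obtain ⟨e⟩ := Cardinal.eq.1 ((mk_ord_toType κ).trans hι.symm)
    exact ⟨E ∘ e, fun i j hij => hd (e.injective.ne hij), fun i => hE (e i)⟩
  choose E hEd hE using hE
  refine ⟨κ.ord.ToType, fun i => ⋃ Y, E Y i, mk_ord_toType κ, fun i j hij => ?_, fun i =>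
    ⟨subset_univ _, ?_⟩⟩
  · simp only [disjoint_iUnion_left, disjoint_iUnion_right]
    intro Y Z
    by_cases hYZ : Z = Y
    · subst hYZ; exact hEd Z hij
    · exact (hdisj Z.2 Y.2 (Subtype.coe_injective.ne hYZ)).mono (hE _ _).1 (hE _ _).1
  · rw [← hdense.closure_eq]
    refine closure_minimal (sUnion_subset fun Y hY => ?_) isClosed_closure
    exact ((hE ⟨Y, hY⟩ i).2).trans (closure_mono (subset_iUnion (fun Y => E Y i) ⟨Y, hY⟩))

theorem HasDisjointDense.resolvable [Nonempty X] {κ : Cardinal.{u}}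
    (h : HasDisjointDense κ (univ : Set X)) : Resolvable X κ := by
  obtain ⟨ι, E, rfl, hd, hE⟩ := h
  have hdense (i : ι) : Dense (E i) := fun x => (hE i).2 (mem_univ x)
  refine ⟨range E, mk_range_eq E fun i j hij => ?_, forall_mem_range.2 hdense, ?_⟩
  · by_contra hne
    obtain ⟨x, hx⟩ := (hdense i).nonempty
    exact disjoint_left.1 (hd hne) hx (hij ▸ hx)
  · rintro _ ⟨i, rfl⟩ _ ⟨j, rfl⟩ hij
    exact hd fun h => hij (congrArg E h)

end DisjointDense

section EquinumerousOpens

variable {X : Type u} [TopologicalSpace X]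

/-- All nonempty open subsets of `X` have the cardinality of `X`. -/
def EquinumerousOpens (X : Type u) [TopologicalSpace X] : Prop :=
  ∀ U : Set X, IsOpen U → U.Nonempty → #U = #X

theorem EquinumerousOpens.mk_diff (hX : EquinumerousOpens X) (hinf : ℵ₀ ≤ #X) {U S : Set X}
    (hU : IsOpen U) (hne : U.Nonempty) (hS : #S < #X) : #(U \ S : Set X) = #X := by
  refine (mk_set_le _).antisymm (le_of_not_gt fun h => ?_)
  have : #X ≤ #(U \ S : Set X) + #S := by
    rw [← hX U hU hne]
    exact (mk_le_mk_of_subset (by rw [sdiff_union_self]; exact subset_union_left)).trans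
      (mk_union_le _ _)
  exact this.not_gt (add_lt_of_lt hinf h hS)

theorem EquinumerousOpens.diff_nonempty (hX : EquinumerousOpens X) {U S : Set X}
    (hU : IsOpen U) (hne : U.Nonempty) (hS : #S < #X) : (U \ S).Nonempty := by
  rw [Set.sdiff_nonempty]
  intro h
  exact ((hX U hU hne).symm.le.trans (mk_le_mk_of_subset h)).not_gt hS

theorem EquinumerousOpens.subset_closure_diff (hX : EquinumerousOpens X) {U S : Set X}
    (hU : IsOpen U) (hS : #S < #X) : U ⊆ closure (U \ S) := by
  intro x hx
  rw [mem_closure_iff]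
  intro O hO hxO
  obtain ⟨y, ⟨hyO, hyU⟩, hyS⟩ := hX.diff_nonempty (hO.inter hU) ⟨x, hxO, hx⟩ hS
  exact ⟨y, hyO, hyU, hyS⟩

theorem NoDiscrete.mk_lt_of_pairwiseDisjoint_isOpen {ρ : Cardinal.{u}} (hd : NoDiscrete X ρ)
    {𝒟 : Set (Set X)} (hopen : ∀ U ∈ 𝒟, IsOpen U) (hne : ∀ U ∈ 𝒟, U.Nonempty)
    (hdisj : 𝒟.PairwiseDisjoint id) : #𝒟 < ρ := by
  by_contra! h
  choose p hp using fun U : 𝒟 => hne U U.2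
  have hp' (U V : 𝒟) (hV : p V ∈ U.1) : V = U := by
    by_contra hUV
    exact disjoint_left.1 (hdisj V.2 U.2 (Subtype.coe_injective.ne hUV)) (hp V) hV
  refine hd.mono h ⟨range p, discreteTopology_subtype_iff'.2 ?_, mk_range_eq p fun U V hUV =>
    hp' V U (hUV ▸ hp V)⟩
  rintro _ ⟨U, rfl⟩
  refine ⟨U, hopen U U.2, Subset.antisymm ?_ (singleton_subset_iff.2 ⟨hp U, mem_range_self U⟩)⟩
  rintro _ ⟨hx, V, rfl⟩
  rw [hp' U V hx]
  rfl

/-- Either `X` splits into `#X` dense sets, or it contains a subspace of full size in which small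
sets are nowhere dense. -/
theorem EquinumerousOpens.hasDisjointDense_or_exists_subspace (hX : EquinumerousOpens X)
    (hinf : ℵ₀ ≤ #X) {ρ : Cardinal.{u}} (hρ : ρ.IsRegular) (hρX : ρ ≤ #X)
    (hd : NoDiscrete X ρ) :
    HasDisjointDense #X (univ : Set X) ∨ ∃ Y : Set X, #Y = #X ∧ EquinumerousOpens Y ∧
      ∀ B : Set Y, #B < ρ → interior (closure B) = ∅ := by
  by_cases H : ∀ S : Set X, #S < #X → ∀ U : Set X, IsOpen U → U.Nonempty →
    ∃ V ⊆ U, IsOpen V ∧ V.Nonempty ∧ ∃ B : Set X, #B < ρ ∧ Disjoint B S ∧ V ⊆ closure B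
  · left
    have hdense (S : Set X) (hS : #S < #X) :
        ∃ B : Set X, (#B < ρ ∧ Dense B) ∧ Disjoint B S := by
      obtain ⟨𝒟, h𝒟, hdisj, hdense⟩ := exists_disjoint_family_dense
        {V : Set X | IsOpen V ∧ V.Nonempty ∧ ∃ B : Set X, #B < ρ ∧ Disjoint B S ∧ V ⊆ closure B}
        (fun V hV => hV.2.1) fun U hU hne => by
          obtain ⟨V, hVU, hV⟩ := H S hS U hU hne
          exact ⟨V, hV, hVU⟩
      choose B hBρ hBS hB using fun V : 𝒟 => (h𝒟 V.2).2.2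
      have hcard : #𝒟 < ρ := hd.mk_lt_of_pairwiseDisjoint_isOpen (fun V hV => (h𝒟 hV).1)
        (fun V hV => (h𝒟 hV).2.1) hdisj
      refine ⟨⋃ V, B V, ⟨hρ.mk_iUnion_lt le_rfl hcard hBρ, ?_⟩, disjoint_iUnion_left.2 hBS⟩
      rw [← dense_closure]
      refine hdense.mono (sUnion_subset fun V hV => ?_)
      exact (hB ⟨V, hV⟩).trans (closure_mono (subset_iUnion B ⟨V, hV⟩))
    obtain ⟨g, hg, hgX⟩ := exists_injective_ordinal_card_lt X
    obtain ⟨A, hA, hAd⟩ := exists_pairwise_disjoint_selection g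
      (fun _ A => #A < ρ ∧ Dense A) fun p S F hS hF => by
        refine hdense _ (hρ.mk_biUnion_lt hρX ?_ fun q hq => (hF q hq).1)
        refine ((mk_le_mk_of_subset hS).trans (mk_setOf_le_le_of_injective hg (g p))).trans_lt ?_
        exact add_lt_of_lt hinf (hgX p) (one_lt_aleph0.trans_le hinf)
    exact ⟨X, A, rfl, hAd, fun i => ⟨subset_univ _, fun x _ => (hA i).2 x⟩⟩
  · right
    push Not at H
    obtain ⟨S, hS, U, hU, hne, H⟩ := H
    refine ⟨U \ S, hX.mk_diff hinf hU hne hS, fun V hV hVne => ?_, fun B hB => ?_⟩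
    · obtain ⟨W, hW, rfl⟩ := isOpen_induced_iff.1 hV
      obtain ⟨x, hx⟩ := hVne
      rw [hX.mk_diff hinf hU hne hS,
        ← hX.mk_diff hinf (hU.inter hW) ⟨x, x.2.1, hx⟩ hS,
        ← mk_image_eq (s := Subtype.val ⁻¹' W) Subtype.val_injective, Subtype.image_preimage_coe]
      congr 2
      ext y
      simp only [mem_inter_iff, mem_sdiff]
      tauto
    · by_contra hint
      obtain ⟨x, hx⟩ := nonempty_iff_ne_empty.2 hint
      obtain ⟨W, hW, hWB⟩ := isOpen_induced_iff.1 (isOpen_interior (s := closure B))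
      have hxW : (x : X) ∈ W := by
        rw [← hWB] at hx
        exact hx
      refine H (U ∩ W) inter_subset_left (hU.inter hW) ⟨x, x.2.1, hxW⟩ ((↑) '' B)
        (mk_image_le.trans_lt hB) ?_ ?_
      · rw [disjoint_left]
        rintro _ ⟨y, -, rfl⟩
        exact y.2.2
      · refine (hX.subset_closure_diff (hU.inter hW) hS).trans
          (closure_minimal ?_ isClosed_closure)
        rintro y ⟨⟨hyU, hyW⟩, hyS⟩
        have : (⟨y, hyU, hyS⟩ : (U \ S : Set X)) ∈ interior (closure B) := by
          rw [← hWB]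
          exact hyW
        exact closure_subtype.1 (interior_subset this)

end EquinumerousOpens

section Traps

variable {X : Type u} [TopologicalSpace X] {ρ : Cardinal.{u}}

/-- No set of size less than `ρ` that avoids `S` accumulates at `x`. -/
def Traps (ρ : Cardinal.{u}) (S : Set X) (x : X) : Prop :=
  ∀ A : Set X, #A < ρ → Disjoint A S → x ∉ closure A

/-- The least size of a set trapping `x`. -/
noncomputable def trapNumber (ρ : Cardinal.{u}) (x : X) : Cardinal.{u} :=
  sInf {c | ∃ S : Set X, #S = c ∧ Traps ρ S x}

theorem exists_mk_eq_trapNumber (ρ : Cardinal.{u}) (x : X) :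
    ∃ S : Set X, #S = trapNumber ρ x ∧ Traps ρ S x := by
  refine csInf_mem (s := {c | ∃ S : Set X, #S = c ∧ Traps ρ S x}) ⟨#(univ : Set X), univ, rfl,
    fun A _ hA => ?_⟩
  rw [disjoint_univ.1 hA, closure_empty]
  exact notMem_empty x

theorem trapNumber_le {S : Set X} {x : X} (h : Traps ρ S x) : trapNumber ρ x ≤ #S :=
  csInf_le' ⟨S, rfl, h⟩

/-- If small sets are nowhere dense and discrete sets are smaller still, then few sets suffice to
cover a nonempty open set by traps that are as small as possible. -/
theorem exists_isOpen_covered_by_traps [Nonempty X] {δ : Cardinal.{u}} (hδ : δ < ρ)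
    (hd : NoDiscrete X δ) (hN : ∀ B : Set X, #B < ρ → interior (closure B) = ∅) :
    ∃ U : Set X, IsOpen U ∧ U.Nonempty ∧ ∃ (I : Type u) (T : I → Set X), #I < ρ ∧
      ∀ x ∈ U, ∃ i, x ∈ T i ∧ #(T i) ≤ trapNumber ρ x := by
  choose S hS hST using fun x : X => exists_mk_eq_trapNumber ρ x
  let ι := δ.ord.ToType
  have hι : #ι = δ := mk_ord_toType δ
  let C : ι → (ι → X) → Set X := fun i z => {x | x ∉ closure (z '' Iio i) ∧ ∀ j < i, x ∉ S (z j)}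
  obtain ⟨z, hz⟩ := (wellFounded_lt (α := ι)).exists_recursive_choice
    (fun i z a => (C i z).Nonempty → a ∈ C i z ∧ ∀ x ∈ C i z, trapNumber ρ a ≤ trapNumber ρ x)
    (fun i F G a h => by
      have : C i F = C i G := by
        ext x
        have h₁ : F '' Iio i = G '' Iio i := image_congr fun j hj => h j hj
        have h₂ : (∀ j < i, x ∉ S (F j)) ↔ ∀ j < i, x ∉ S (G j) :=
          forall₂_congr fun j hj => by rw [h j hj]
        simp only [C, mem_ofPred_eq, h₁, h₂]
      rw [this]
      exact id)
    (fun i F _ => by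
      by_cases hne : (C i F).Nonempty
      · obtain ⟨a, ha, hmin⟩ := (InvImage.wf (trapNumber ρ) wellFounded_lt).has_min _ hne
        exact ⟨a, fun _ => ⟨ha, fun x hx => not_lt.1 (hmin x hx)⟩⟩
      · exact ⟨Classical.arbitrary X, fun h => absurd h hne⟩)
  have hall : ∃ i, ¬ (C i z).Nonempty := by
    by_contra! hall
    refine NoDiscrete.false_of_separated (ι := ι) (hι ▸ hd) z (fun i => (hz i (hall i)).1.1)
      fun i => hST (z i) _ (mk_image_le.trans_lt (((mk_set_le _).trans_eq hι).trans_lt hδ)) ?_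
    rw [disjoint_left]
    rintro _ ⟨j, hj, rfl⟩
    exact (hz j (hall j)).1.2 i hj
  obtain ⟨γ, hγ, -⟩ := (wellFounded_lt (α := ι)).has_min {i | ¬ (C i z).Nonempty} hall
  refine ⟨(closure (z '' Iio γ))ᶜ, isClosed_closure.isOpen_compl, ?_, Iio γ, fun i => S (z i),
    ((mk_set_le _).trans_eq hι).trans_lt hδ, fun x hx => ?_⟩
  · rw [nonempty_compl]
    intro h
    have := hN (z '' Iio γ) (mk_image_le.trans_lt (((mk_set_le _).trans_eq hι).trans_lt hδ))
    rw [h, interior_univ] at this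
    exact univ_nonempty.ne_empty this
  · have hex : {j | j < γ ∧ x ∈ S (z j)}.Nonempty := by
      by_contra! h
      refine hγ ⟨x, hx, fun j hj hxj => ?_⟩
      exact (eq_empty_iff_forall_notMem.1 h) j ⟨hj, hxj⟩
    obtain ⟨j, ⟨hj, hxj⟩, hmin⟩ := (wellFounded_lt (α := ι)).has_min _ hex
    have hxC : x ∈ C j z :=
      ⟨fun h => hx (closure_mono (image_mono (Iio_subset_Iio hj.le)) h),
        fun k hk hxk => hmin k ⟨hk.trans hj, hxk⟩ hk⟩
    exact ⟨⟨j, hj⟩, hxj, (hS _).trans_le ((hz j ⟨x, hxC⟩).2 x hxC)⟩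

/-- An open set covered by few traps of least size splits into `#X` dense sets. -/
theorem EquinumerousOpens.hasDisjointDense_of_covered_by_traps (hX : EquinumerousOpens X)
    (hinf : ℵ₀ ≤ #X) (hρ : ρ.IsRegular) (hρX : ρ ≤ #X) {U : Set X} (hU : IsOpen U)
    {I : Type u} {T : I → Set X} (hI : #I < ρ)
    (hT : ∀ x ∈ U, ∃ i, x ∈ T i ∧ #(T i) ≤ trapNumber ρ x) : HasDisjointDense #X U := by
  choose b hbT hbτ using fun x : U => hT x x.2
  obtain ⟨g', hg', hgX⟩ := exists_injective_ordinal_card_lt X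
  choose g hg hgT using fun i => exists_injective_ordinal_card_lt (T i)
  let f : U → Ordinal.{u} := fun x => g (b x) ⟨x, hbT x⟩
  have hf (x : U) : (f x).card < trapNumber ρ x.1 := (hgT _ _).trans_le (hbτ x)
  have hfle (o : Ordinal.{u}) : #{x | f x ≤ o} ≤ #I * (o.card + 1) := by
    have h : #{x | f x ≤ o} ≤ #(Σ i, {y : T i | g i y ≤ o}) :=
      mk_le_of_injective (f := fun x => ⟨b x.1, ⟨x.1, hbT _⟩, x.2⟩) fun x y hxy =>
        Subtype.ext (Subtype.ext (congrArg (fun s => (s.2.1 : X)) hxy))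
    refine h.trans ?_
    rw [mk_sigma]
    refine (sum_le_sum _ _ fun i => mk_setOf_le_le_of_injective (hg i) o).trans ?_
    simp
  let P := {p : U × X // ρ ≤ trapNumber ρ p.1.1 ∧ (g' p.2).card < trapNumber ρ p.1.1}
  let key : P → Ordinal.{u} := fun p => max (f p.1.1) (g' p.1.2)
  have hkey (p : P) (S : Set P) (hS : ∀ q ∈ S, key q ≤ key p) :
      #S < trapNumber ρ p.1.1.1 := by
    have hinfτ : ℵ₀ ≤ trapNumber ρ p.1.1.1 := hρ.aleph0_le.trans p.2.1
    have hc : (key p).card < trapNumber ρ p.1.1.1 := by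
      rcases max_choice (f p.1.1) (g' p.1.2) with h | h
      · exact (congrArg Ordinal.card h).trans_lt (hf _)
      · exact (congrArg Ordinal.card h).trans_lt p.2.2
    have hc' := add_lt_of_lt hinfτ hc (one_lt_aleph0.trans_le hinfτ)
    have h : #S ≤ #({x | f x ≤ key p} ×ˢ {y | g' y ≤ key p} : Set (U × X)) :=
      mk_le_of_injective (f := fun q => ⟨q.1.1, (le_max_left _ _).trans (hS q.1 q.2),
        (le_max_right _ _).trans (hS q.1 q.2)⟩) fun q s hqs => 
          Subtype.ext (Subtype.ext (Subtype.mk.inj hqs))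
    refine h.trans_lt ?_
    rw [mk_setProd]
    refine (mul_le_mul' (hfle _) (mk_setOf_le_le_of_injective hg' _)).trans_lt ?_
    exact mul_lt_of_lt hinfτ (mul_lt_of_lt hinfτ (hI.trans_le p.2.1) hc') hc'
  obtain ⟨A, hA, hAd⟩ := exists_pairwise_disjoint_selection key
    (fun p A => #A < ρ ∧ p.1.1.1 ∈ closure A) fun p S F hS hF => by
      have h : #(⋃ q ∈ S, F q) < trapNumber ρ p.1.1.1 :=
        hρ.mk_biUnion_lt p.2.1 (hkey p S hS) fun q hq => (hF q hq).1
      by_contra! hno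
      exact (trapNumber_le fun A hA hdisj hmem => hno A ⟨hA, hmem⟩ hdisj).not_gt h
  refine ⟨X, fun j => U ∩ ⋃ p : {p : P // p.1.2 = j}, A p, rfl, fun i j hij => ?_, fun j =>
    ⟨inter_subset_left, fun y hy => ?_⟩⟩
  · refine Disjoint.mono inter_subset_right inter_subset_right ?_
    simp only [disjoint_iUnion_left, disjoint_iUnion_right]
    intro q p
    exact hAd fun h => hij (p.2.symm.trans ((congrArg (fun r : P => r.1.2) h).trans q.2))
  rw [mem_closure_iff]
  intro W hW hyW
  have hWU := hW.inter hU
  have h₁ : #(⋃ i ∈ {i | #(T i) < ρ}, T i) < #X :=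
    hρ.mk_biUnion_lt hρX (((mk_set_le _).trans_lt hI).trans_le hρX) fun i hi => hi
  have h₂ : #(⋃ i ∈ {i | #(T i) ≤ (g' j).card}, T i) < #X := by
    refine ((mk_biUnion_le _ _).trans (mul_le_mul' (mk_set_le _) (ciSup_le' fun i => i.2))).trans_lt
      (mul_lt_of_lt hinf (hI.trans_le hρX) (hgX j))
  obtain ⟨x, hxU, hx⟩ := hX.diff_nonempty hWU ⟨y, hyW, hy⟩
    ((mk_union_le _ _).trans_lt (add_lt_of_lt hinf h₁ h₂))
  simp only [mem_union, mem_iUnion, mem_ofPred_eq, not_or, not_exists] at hx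
  have hp₁ : ρ ≤ trapNumber ρ x :=
    (not_lt.1 fun h => hx.1 (b ⟨x, hxU.2⟩) h (hbT ⟨x, hxU.2⟩)).trans (hbτ ⟨x, hxU.2⟩)
  have hp₂ : (g' j).card < trapNumber ρ x :=
    (not_le.1 fun h => hx.2 (b ⟨x, hxU.2⟩) h (hbT ⟨x, hxU.2⟩)).trans_le (hbτ ⟨x, hxU.2⟩)
  let p : P := ⟨(⟨x, hxU.2⟩, j), hp₁, hp₂⟩
  obtain ⟨a, haW, haA⟩ := mem_closure_iff.1 (hA p).2 (W ∩ U) hWU hxU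
  exact ⟨a, haW.1, haW.2, mem_iUnion.2 ⟨⟨p, rfl⟩, haA⟩⟩

end Traps

section Thin

variable {ι : Type u} [LinearOrder ι]

/-- `A` is thin (nonstationary) if it meets the set of closure points of some function
`g : ι → ι` in at most the least element of `ι`. -/
def IsThin (A : Set ι) : Prop :=
  ∃ g : ι → ι, ∀ a ∈ A, IsMin a ∨ ∃ b < a, a ≤ g b

theorem IsThin.mono {A B : Set ι} (h : A ⊆ B) (hB : IsThin B) : IsThin A := by
  obtain ⟨g, hg⟩ := hB
  exact ⟨g, fun a ha => hg a (h ha)⟩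

theorem isThin_Iic (s : ι) : IsThin (Iic s) :=
  ⟨fun _ => s, fun a ha => or_iff_not_imp_left.2 fun h => by
    obtain ⟨b, hb⟩ := not_isMin_iff.1 h
    exact ⟨b, hb, ha⟩⟩

theorem IsThin.iUnion {κ : Cardinal.{u}} (hb : ∀ s : Set ι, #s < κ → ∃ b, ∀ a ∈ s, a < b)
    {J : Type u} (hJ : #J < κ) {A : J → Set ι} (hA : ∀ j, IsThin (A j)) : IsThin (⋃ j, A j) := by
  choose g hg using hA
  choose G hG using fun b => hb (range fun j => g j b) (mk_range_le.trans_lt hJ)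
  refine ⟨G, fun a ha => ?_⟩
  obtain ⟨j, hj⟩ := mem_iUnion.1 ha
  refine (hg j a hj).imp_right ?_
  rintro ⟨b, hba, hab⟩
  exact ⟨b, hba, hab.trans (hG b _ ⟨j, rfl⟩).le⟩

theorem IsThin.union {A B : Set ι} (hA : IsThin A) (hB : IsThin B) : IsThin (A ∪ B) := by
  obtain ⟨g, hg⟩ := hA
  obtain ⟨h, hh⟩ := hB
  refine ⟨fun b => max (g b) (h b), ?_⟩
  rintro a (ha | ha)
  · exact (hg a ha).imp_right fun ⟨b, hba, hab⟩ => ⟨b, hba, hab.trans (le_max_left _ _)⟩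
  · exact (hh a ha).imp_right fun ⟨b, hba, hab⟩ => ⟨b, hba, hab.trans (le_max_right _ _)⟩

theorem not_isThin_univ [WellFoundedLT ι] [Nonempty ι] {κ : Cardinal.{u}} (hκ : ℵ₀ < κ)
    (hb : ∀ s : Set ι, #s < κ → ∃ b, ∀ a ∈ s, a < b) (hIic : ∀ a : ι, #(Iic a) < κ) :
    ¬ IsThin (univ : Set ι) := by
  rintro ⟨g, hg⟩
  choose h hh using fun a => hb (insert a (g '' Iic a)) <|
    mk_insert_le.trans_lt <| add_lt_of_lt hκ.le (mk_image_le.trans_lt (hIic a))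
      (one_lt_aleph0.trans hκ)
  let a : ℕ → ι := fun n => h^[n] (Classical.arbitrary ι)
  have ha (n : ℕ) : a (n + 1) = h (a n) := Function.iterate_succ_apply' h n _
  obtain ⟨s, hs, hmin⟩ := (wellFounded_lt (α := ι)).has_min {s | ∀ n, a n < s} <| by
    obtain ⟨s, hs⟩ := hb (range a) ((countable_range a).le_aleph0.trans_lt hκ)
    exact ⟨s, fun n => hs _ ⟨n, rfl⟩⟩
  rcases hg s (mem_univ s) with h₀ | ⟨b, hbs, hsb⟩
  · exact h₀.not_lt (hs 0)
  · obtain ⟨n, hn⟩ : ∃ n, b ≤ a n := by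
      by_contra! hlt
      exact hmin b hlt hbs
    have h₁ : g b < a (n + 1) := by
      rw [ha]
      exact hh (a n) _ (mem_insert_of_mem _ ⟨b, hn, rfl⟩)
    exact (hsb.trans_lt h₁).not_gt (hs (n + 1))

theorem isThin_range {z : ι → ι} (hz : Monotone z) (h : ∀ a, ∃ s < z a, ∀ b < a, z b ≤ s) :
    IsThin (range z) := by
  have hg (s : ι) : ∃ c, (∃ a, s < z a) → ∃ m, c = z m ∧ s < z m := by
    by_cases hs : ∃ a, s < z a
    · obtain ⟨m, hm⟩ := hs
      exact ⟨z m, fun _ => ⟨m, rfl, hm⟩⟩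
    · exact ⟨s, fun h => absurd h hs⟩
  choose g hg using hg
  refine ⟨g, ?_⟩
  rintro _ ⟨a, rfl⟩
  obtain ⟨s, hsa, hs⟩ := h a
  obtain ⟨m, hm, hsm⟩ := hg s ⟨a, hsa⟩
  refine Or.inr ⟨s, hsa, ?_⟩
  rw [hm]
  exact hz (not_lt.1 fun hma => (hs m hma).not_gt hsm)

end Thin

section Regular

variable {X : Type u} [TopologicalSpace X]

/-- In a space of regular uncountable size without discrete subsets of full size, in which smaller
sets are not dense, some subset splits into as many dense sets as `X` has points. -/
theorem exists_hasDisjointDense_of_isRegular (hreg : (#X).IsRegular) (hunc : ℵ₀ < #X)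
    (hd : NoDiscrete X #X) (hN : ∀ B : Set X, #B < #X → closure B ≠ Set.univ) :
    ∃ Y : Set X, Y.Nonempty ∧ HasDisjointDense #X Y := by
  let ι := (#X).ord.ToType
  have hι : #ι = #X := mk_ord_toType _
  have hIio (a : ι) : #(Iio a) < #X := (mk_Iio_lt a (by simp [ι])).trans_eq hι
  have hIic (a : ι) : #(Iic a) < #X := by
    rw [← Iio_insert]
    exact mk_insert_le.trans_lt (add_lt_of_lt hunc.le (hIio a) (one_lt_aleph0.trans hunc))
  have hb (s : Set ι) (hs : #s < #X) : ∃ b, ∀ a ∈ s, a < b := by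
    have h : #(⋃ a ∈ s, Iic a) < #X := hreg.mk_biUnion_lt le_rfl hs fun a _ => hIic a
    by_contra! hno
    have huniv : ⋃ a ∈ s, Iic a = Set.univ := eq_univ_of_forall fun b => by
      obtain ⟨a, ha, hba⟩ := hno b
      exact mem_biUnion ha hba
    rw [huniv, mk_univ] at h
    exact h.ne hι
  have : Nonempty X := mk_ne_zero_iff.1 (aleph0_pos.trans hunc).ne'
  have : Nonempty ι := mk_ne_zero_iff.1 (hι ▸ (aleph0_pos.trans hunc).ne')
  obtain ⟨y, hy⟩ := (wellFounded_lt (α := ι)).exists_recursive_choice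
    (fun i F a => a ∉ closure (F '' Iio i))
    (fun i F G a h => by
      rw [show F '' Iio i = G '' Iio i from image_congr fun j hj => h j hj]
      exact id)
    (fun i F _ => (ne_univ_iff_exists_notMem _).1 (hN _ (mk_image_le.trans_lt (hIio i))))
  have hyinj : Function.Injective y := .of_lt_imp_ne fun i j hij h =>
    hy j (subset_closure (show y j ∈ y '' Iio j from ⟨i, hij, h⟩))
  let Bad : ι → Set ι → Prop := fun i S => ∀ A, IsThin A → Disjoint A S → y i ∉ closure (y '' A)
  have hempty : IsThin (∅ : Set ι) := ⟨id, fun _ h => h.elim⟩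
  let V : Set ι := {i | ∃ S, IsThin S ∧ Bad i S}
  have hV : IsThin V := by
    by_contra hV
    have hS (i : ι) : ∃ S, IsThin S ∧ (i ∈ V → Bad i S) := by
      by_cases hi : i ∈ V
      · obtain ⟨S, hS, hbad⟩ := hi
        exact ⟨S, hS, fun _ => hbad⟩
      · exact ⟨∅, hempty, fun h => absurd h hi⟩
    choose S hST hSbad using hS
    obtain ⟨z, hz⟩ := (wellFounded_lt (α := ι)).exists_recursive_choice
      (fun a F c => c ∈ V ∧ (∀ b < a, c ∉ S (F b)) ∧ ∃ s < c, ∀ b < a, F b ≤ s)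
      (fun a F G c h => by
        rintro ⟨h₁, h₂, s, hs, h₃⟩
        exact ⟨h₁, fun b hb => h b hb ▸ h₂ b hb, s, hs, fun b hb => h b hb ▸ h₃ b hb⟩)
      (fun a F _ => by
        obtain ⟨s, hs⟩ := hb (F '' Iio a) (mk_image_le.trans_lt (hIio a))
        have hthin : IsThin ((⋃ b : Iio a, S (F b)) ∪ Iic s) :=
          (IsThin.iUnion hb (hIio a) fun b => hST _).union (isThin_Iic s)
        obtain ⟨c, hcV, hc⟩ := not_subset.1 fun h => hV (hthin.mono h)
        simp only [mem_union, mem_iUnion, mem_Iic, not_or, not_exists, not_le] at hc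
        exact ⟨c, hcV, fun b hb => hc.1 ⟨b, hb⟩, s, hc.2, fun b hb => (hs _ ⟨b, hb, rfl⟩).le⟩)
    have hzmono : StrictMono z := fun b a hba => by
      obtain ⟨-, -, s, hs, h⟩ := hz a
      exact (h b hba).trans_lt hs
    refine NoDiscrete.false_of_separated (ι := ι) (hι ▸ hd) (y ∘ z) (fun a h => ?_) fun a => ?_
    · refine hy (z a) (closure_mono ?_ h)
      rw [image_comp]
      exact image_mono (image_subset_iff.2 fun b hb => hzmono hb)
    · rw [image_comp]
      refine hSbad (z a) (hz a).1 _
        ((isThin_range hzmono.monotone fun a => (hz a).2.2).mono (image_subset_range _ _)) ?_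
      rw [disjoint_left]
      rintro _ ⟨b, hb, rfl⟩
      exact (hz b).2.1 a hb
  obtain ⟨i₀, hi₀⟩ : (Vᶜ).Nonempty := by
    rw [nonempty_compl]
    exact fun h => not_isThin_univ hunc hb hIic (h ▸ hV)
  obtain ⟨g, hg, hgP⟩ := exists_injective_ordinal_card_lt ((Vᶜ : Set ι) × ι)
  have hP : #((Vᶜ : Set ι) × ι) ≤ #X := by
    rw [mk_prod, lift_id, lift_id, hι]
    exact (mul_le_mul' ((mk_set_le _).trans_eq hι) le_rfl).trans (mul_eq_self hunc.le).le
  obtain ⟨A, hA, hAd⟩ := exists_pairwise_disjoint_selection g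
    (fun p A => IsThin A ∧ Disjoint A V ∧ y p.1 ∈ closure (y '' A)) fun p S F hS hF => by
      have hcard : #S < #X :=
        ((mk_le_mk_of_subset hS).trans (mk_setOf_le_le_of_injective hg (g p))).trans_lt
          (add_lt_of_lt hunc.le ((hgP p).trans_le hP) (one_lt_aleph0.trans hunc))
      have hthin : IsThin ((⋃ q ∈ S, F q) ∪ V) := by
        rw [biUnion_eq_iUnion]
        exact (IsThin.iUnion hb hcard fun q => (hF q q.2).1).union hV
      by_contra! hno
      refine p.1.2 ⟨_, hthin, fun A hA hdisj hmem => ?_⟩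
      rw [disjoint_union_right] at hdisj
      exact hno A ⟨hA, hdisj.2, hmem⟩ hdisj.1
  refine ⟨y '' Vᶜ, ⟨_, i₀, hi₀, rfl⟩, ι, fun j => y '' ⋃ i, A (i, j), hι, fun j k hjk => ?_,
    fun j => ⟨image_mono (iUnion_subset fun i => ?_), ?_⟩⟩
  · refine (disjoint_image_iff hyinj).2 ?_
    simp only [disjoint_iUnion_left, disjoint_iUnion_right]
    exact fun _ _ => hAd fun h => hjk (congrArg Prod.snd h)
  · exact (hA _).2.1.subset_compl_right
  · rintro _ ⟨i, hi, rfl⟩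
    exact closure_mono (image_mono (subset_iUnion (fun i => A (i, j)) ⟨i, hi⟩))
      (hA (⟨i, hi⟩, j)).2.2

end Regular

section Main

variable {X : Type u} [TopologicalSpace X]

theorem EquinumerousOpens.hasDisjointDense_of_finite (hX : EquinumerousOpens X) [Finite X] :
    HasDisjointDense #X (Set.univ : Set X) := by
  refine ⟨X, fun x => {x}, rfl, fun x y hxy => disjoint_singleton.2 hxy, fun x =>
    ⟨subset_univ _, fun y _ => mem_closure_iff.2 fun O hO hyO => ?_⟩⟩
  have hcard : O.ncard = Nat.card X := congrArg toNat (hX O hO ⟨y, hyO⟩)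
  rw [(eq_univ_iff_ncard O).2 hcard]
  exact ⟨x, mem_univ x, rfl⟩

theorem EquinumerousOpens.exists_hasDisjointDense [Nonempty X] (hX : EquinumerousOpens X)
    {μ : Cardinal.{u}} (hμ : Order.succ μ ≤ #X) (hd : NoDiscrete X (Order.succ μ)) :
    ∃ Y : Set X, Y.Nonempty ∧ HasDisjointDense #X Y := by
  rcases lt_or_ge #X ℵ₀ with hfin | hinf
  · have := lt_aleph0_iff_finite.1 hfin
    exact ⟨Set.univ, univ_nonempty, hX.hasDisjointDense_of_finite⟩
  rcases hμ.eq_or_lt with heq | hlt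
  · have hμinf : ℵ₀ ≤ μ := by
      by_contra! h
      exact (isSuccLimit_aleph0.succ_lt h).not_ge (heq ▸ hinf)
    have hunc : ℵ₀ < #X := heq ▸ Order.lt_succ_of_le hμinf
    have hreg : (#X).IsRegular := heq ▸ isRegular_succ hμinf
    rw [heq] at hd
    rcases hX.hasDisjointDense_or_exists_subspace hinf hreg le_rfl hd with h | ⟨Y, hY, hYX, hN⟩
    · exact ⟨Set.univ, univ_nonempty, h⟩
    · have : Nonempty Y := mk_ne_zero_iff.1 (hY ▸ mk_ne_zero X)
      rw [← hY] at hreg hunc hd hN ⊢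
      obtain ⟨Z, hZ, h⟩ := exists_hasDisjointDense_of_isRegular hreg hunc (hd.subtype Y)
        fun B hB hBu => by
          have := hN B hB
          rw [hBu, interior_univ] at this
          exact univ_nonempty.ne_empty this
      exact ⟨_, hZ.image _, h.image_val⟩
  · obtain ⟨ρ, hρ, hμρ, hρX⟩ : ∃ ρ : Cardinal.{u}, ρ.IsRegular ∧ Order.succ μ < ρ ∧ ρ ≤ #X := by
      rcases lt_or_ge (Order.succ μ) ℵ₀ with h | h
      · exact ⟨ℵ₀, isRegular_aleph0, h, hinf⟩
      · exact ⟨_, isRegular_succ h, Order.lt_succ _, Order.succ_le_of_lt hlt⟩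
    rcases hX.hasDisjointDense_or_exists_subspace hinf hρ hρX (hd.mono hμρ.le) with
      h | ⟨Y, hY, hYX, hN⟩
    · exact ⟨Set.univ, univ_nonempty, h⟩
    · have : Nonempty Y := mk_ne_zero_iff.1 (hY ▸ mk_ne_zero X)
      rw [← hY] at hinf hρX ⊢
      obtain ⟨U, hU, hne, I, T, hI, hT⟩ := exists_isOpen_covered_by_traps hμρ (hd.subtype Y) hN
      exact ⟨_, hne.image _,
        (hYX.hasDisjointDense_of_covered_by_traps hinf hρ hρX hU hI hT).image_val⟩

/-- Every nonempty open set contains a nonempty open set all of whose nonempty open subsets have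
the same cardinality. -/
theorem exists_isOpen_equinumerousOpens {U : Set X} (hU : IsOpen U) (hne : U.Nonempty) :
    ∃ V ⊆ U, IsOpen V ∧ V.Nonempty ∧ EquinumerousOpens V := by
  obtain ⟨V, ⟨hVU, hV, hVne⟩, hmin⟩ :=
    (InvImage.wf (fun V : Set X => #V) wellFounded_lt).has_min
      {V : Set X | V ⊆ U ∧ IsOpen V ∧ V.Nonempty} ⟨U, Subset.rfl, hU, hne⟩
  refine ⟨V, hVU, hV, hVne, fun W hW hWne => (mk_set_le W).antisymm ?_⟩
  rw [← mk_image_eq (s := W) Subtype.val_injective]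
  exact not_lt.1 (hmin _ ⟨(Subtype.coe_image_subset V W).trans hVU,
    hV.isOpenMap_subtype_val W hW, hWne.image _⟩)

theorem delta_le_mk {U : Set X} (hU : IsOpen U) (hne : U.Nonempty) : Delta X ≤ #U :=
  csInf_le' ⟨U, hU, hne, rfl⟩

theorem exists_psInv_eq_succ_and_noDiscrete (X : Type u) [TopologicalSpace X] :
    ∃ μ : Cardinal.{u}, psInv X = Order.succ μ ∧ NoDiscrete X (Order.succ μ) := by
  obtain ⟨⟨μ, hμ⟩, hd⟩ := csInf_mem (s := {c : Cardinal.{u} | (∃ κ, c = Order.succ κ) ∧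
    ¬ ∃ D : Set X, DiscreteTopology D ∧ #D = c}) ⟨Order.succ #X, ⟨_, rfl⟩, fun ⟨D, _, hD⟩ =>
      ((mk_set_le D).trans_lt (Order.lt_succ _)).ne hD⟩
  exact ⟨μ, hμ, hμ ▸ hd⟩

end Main

/-- If Δ(X) ≥ ps(X) then X is maximally resolvable. -/
theorem maximallyResolvable_of_delta_ge_ps (X : Type*) [TopologicalSpace X]
    (h : psInv X ≤ Delta X) : MaximallyResolvable X := by
  obtain ⟨μ, hμ, hd⟩ := exists_psInv_eq_succ_and_noDiscrete X
  rw [hμ] at h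
  have hX : Nonempty X := by
    by_contra hX
    rw [not_nonempty_iff] at hX
    have hD : Delta X = 0 := by
      refine (congrArg sInf (eq_empty_iff_forall_notMem.2 ?_)).trans Cardinal.sInf_empty
      rintro c ⟨U, -, ⟨x, -⟩, -⟩
      exact hX.elim x
    exact (Order.succ_le_iff.1 h).not_ge (hD ▸ zero_le)
  refine HasDisjointDense.resolvable (hasDisjointDense_univ fun U hU hne => ?_)
  obtain ⟨V, hVU, hV, hVne, hVeq⟩ := exists_isOpen_equinumerousOpens hU hne
  have : Nonempty V := hVne.to_subtype
  have hle : Delta X ≤ #V := delta_le_mk hV hVne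
  obtain ⟨Y, hY, hYd⟩ := hVeq.exists_hasDisjointDense (h.trans hle) (hd.subtype V)
  exact ⟨_, (Subtype.coe_image_subset V Y).trans hVU, hY.image _, hYd.image_val.mono hle⟩
end
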